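/- Let W be a singular and asymmetric (i.e., not symmetric) discrete memoryless channel and ε ∈ (0,1/2). Then there exists a constant K̃(ε,W) > 0 such that for every blocklength N ∈ ℤ⁺, ln M*_c(N,ε) ≤ N·C(W) + √(N·V_ε(W))·Φ^{−1}(ε) + K̃(ε,W), where M*_c(N,ε) is the maximum number of messages achievable at blocklength N with average error probability at most ε by constant composition codes. -/

import Mathlib

open Real Finset

variable {X Y : Type} [Fintype X] [Fintype Y]

/-- A discrete memoryless channel: `W x y` is the probability of output `y` given input `x`. -/
def IsDMC (W : X → Y → ℝ) : Prop :=
  (∀ x y, 0 ≤ W x y) ∧ ∀ x, ∑ y, W x y = 1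

/-- A probability distribution on a finite alphabet. -/
def IsProbDist (Q : X → ℝ) : Prop :=
  (∀ x, 0 ≤ Q x) ∧ ∑ x, Q x = 1

/-- Gallager symmetry: the output alphabet can be partitioned into classes such that within
each class every row is a permutation of every other row, and every column is a permutation
of every other column. -/
def GallagerSymmetric (W : X → Y → ℝ) : Prop :=
  ∃ cls : Y → ℕ,
    (∀ (l : ℕ) (x x' : X),
        ((Finset.univ.filter fun y => cls y = l).val.map fun y => W x y) =
        ((Finset.univ.filter fun y => cls y = l).val.map fun y => W x' y)) ∧
    (∀ y y' : Y, cls y = cls y' →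
        (Finset.univ.val.map fun x => W x y) = (Finset.univ.val.map fun x => W x y'))

/-- Singularity: whenever two inputs both give an output positive probability,
they give it the same probability. -/
def Singular (W : X → Y → ℝ) : Prop :=
  ∀ x z y, 0 < W x y * W z y → W x y = W z y

/-- Gallager's function `E_o(ρ, Q)`. -/
noncomputable def Eo (W : X → Y → ℝ) (Q : X → ℝ) (ρ : ℝ) : ℝ :=
  - Real.log (∑ y, (∑ x, Q x * W x y ^ (1 / (1 + ρ))) ^ (1 + ρ))

/-- Mutual information `I(Q; W)`. -/
noncomputable def mutualInfo (W : X → Y → ℝ) (Q : X → ℝ) : ℝ :=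
  ∑ x, ∑ y, Q x * W x y * Real.log (W x y / ∑ z, Q z * W z y)

/-- Channel capacity `C(W)`. -/
noncomputable def capacity (W : X → Y → ℝ) : ℝ :=
  sSup {r | ∃ Q, IsProbDist Q ∧ r = mutualInfo W Q}

/-- The set of values whose supremum is the sphere-packing exponent. -/
def ESPset (W : X → Y → ℝ) (R : ℝ) : Set ℝ :=
  {e | ∃ Q, IsProbDist Q ∧ ∃ ρ : ℝ, 0 ≤ ρ ∧ e = Eo W Q ρ - ρ * R}

/-- The sphere-packing exponent `E_SP(R) = max_Q sup_{ρ ≥ 0} (E_o(ρ,Q) - ρ R)`. -/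
noncomputable def ESP (W : X → Y → ℝ) (R : ℝ) : ℝ := sSup (ESPset W R)

/-- The random coding exponent `E_r(R) = max_Q max_{0 ≤ ρ ≤ 1} (E_o(ρ,Q) - ρ R)`. -/
noncomputable def Er (W : X → Y → ℝ) (R : ℝ) : ℝ :=
  sSup {e | ∃ Q, IsProbDist Q ∧ ∃ ρ : ℝ, 0 ≤ ρ ∧ ρ ≤ 1 ∧ e = Eo W Q ρ - ρ * R}

/-- `R_∞`: the supremum of rates at which the sphere-packing exponent is infinite
(i.e. the defining supremum is unbounded). -/
noncomputable def Rinf (W : X → Y → ℝ) : ℝ :=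
  sSup {R | ¬ BddAbove (ESPset W R)}

/-- The critical rate `R_cr`: the smallest rate above which `E_r = E_SP`. -/
noncomputable def Rcr (W : X → Y → ℝ) : ℝ :=
  sInf {R | ∀ R', R ≤ R' → Er W R' = ESP W R'}

/-- Number of messages of an `(N, R)` code: `⌈e^{NR}⌉`. -/
noncomputable def Mof (N : ℕ) (R : ℝ) : ℕ := ⌈Real.exp (N * R)⌉₊

/-- Error probability of message `m` for a (non-feedback) block code. -/
noncomputable def msgErrorProb (W : X → Y → ℝ) {N M : ℕ}
    (f : Fin M → Fin N → X) (φ : (Fin N → Y) → Fin M) (m : Fin M) : ℝ :=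
  ∑ y ∈ Finset.univ.filter (fun y : Fin N → Y => φ y ≠ m), ∏ n, W (f m n) (y n)

/-- Average error probability of a (non-feedback) block code. -/
noncomputable def avgErrorProb (W : X → Y → ℝ) {N M : ℕ}
    (f : Fin M → Fin N → X) (φ : (Fin N → Y) → Fin M) : ℝ :=
  (M : ℝ)⁻¹ * ∑ m, msgErrorProb W f φ m

/-- A feedback encoder, given as a function of the whole output word, is causal if the symbol
sent at time `n` depends only on the message and the outputs at times `< n`. -/
def Causal {N M : ℕ} (f : Fin M → (Fin N → Y) → Fin N → X) : Prop :=
  ∀ m y y' n, (∀ k, k < n → y k = y' k) → f m y n = f m y' n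

/-- Average error probability of a feedback code. -/
noncomputable def avgErrorProbFb (W : X → Y → ℝ) {N M : ℕ}
    (f : Fin M → (Fin N → Y) → Fin N → X) (φ : (Fin N → Y) → Fin M) : ℝ :=
  (M : ℝ)⁻¹ * ∑ m, ∑ y ∈ Finset.univ.filter (fun y : Fin N → Y => φ y ≠ m),
      ∏ n, W (f m y n) (y n)

/-- The (conditional information) dispersion `V(Q, W)`. -/
noncomputable def Vdisp (W : X → Y → ℝ) (Q : X → ℝ) : ℝ :=
  ∑ x, ∑ y, Q x * W x y *
    (Real.log (W x y / ∑ z, Q z * W z y) -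
      ∑ b, W x b * Real.log (W x b / ∑ z, Q z * W z b)) ^ 2

/-- The `ε`-dispersion `V_ε(W)`: the minimum (for `ε < 1/2`) or maximum (for `ε ≥ 1/2`) of
`V(Q,W)` over capacity-achieving input distributions `Q`. -/
noncomputable def Veps (W : X → Y → ℝ) (ε : ℝ) : ℝ :=
  if ε < 1 / 2 then
    sInf {v | ∃ Q, IsProbDist Q ∧ mutualInfo W Q = capacity W ∧ v = Vdisp W Q}
  else
    sSup {v | ∃ Q, IsProbDist Q ∧ mutualInfo W Q = capacity W ∧ v = Vdisp W Q}

/-- The standard Gaussian cumulative distribution function `Φ`. -/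
noncomputable def stdGaussCDF (x : ℝ) : ℝ :=
  (Real.sqrt (2 * Real.pi))⁻¹ * ∫ t in Set.Iic x, Real.exp (-t ^ 2 / 2)

/-- The inverse `Φ⁻¹` of the standard Gaussian CDF. -/
noncomputable def stdGaussInvCDF (p : ℝ) : ℝ := sInf {x | p ≤ stdGaussCDF x}

/-- A code is constant composition if all codewords have the same empirical distribution. -/
def ConstComp [DecidableEq X] {N M : ℕ} (f : Fin M → Fin N → X) : Prop :=
  ∀ m m' x, (Finset.univ.filter fun n => f m n = x).card =
    (Finset.univ.filter fun n => f m' n = x).card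

lemma integrable_exp_neg_sq_half :
    MeasureTheory.Integrable fun t : ℝ => Real.exp (-t ^ 2 / 2) := by
  have h := integrable_exp_neg_mul_sq (b := 1 / 2) (by norm_num)
  refine h.congr (Filter.Eventually.of_forall fun t => ?_)
  simp only
  congr 1
  ring

lemma sqrt_two_pi_pos : 0 < Real.sqrt (2 * Real.pi) := by positivity

lemma integral_exp_neg_sq_half :
    ∫ t : ℝ, Real.exp (-t ^ 2 / 2) = Real.sqrt (2 * Real.pi) := by
  have h := integral_gaussian (1 / 2)
  rw [show Real.pi / (1 / 2) = 2 * Real.pi by ring] at h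
  rw [← h]
  congr 1
  ext t
  congr 1
  ring

lemma stdGaussCDF_neg (x : ℝ) : stdGaussCDF (-x) = 1 - stdGaussCDF x := by
  have h1 : ∫ t in Set.Iic (-x), Real.exp (-t ^ 2 / 2) = ∫ t in Set.Ioi x, Real.exp (-t ^ 2 / 2) := by
    have := integral_comp_neg_Ioi x (fun t : ℝ => Real.exp (-t ^ 2 / 2))
    rw [← this]
    simp
  have h2 := MeasureTheory.integral_add_compl (measurableSet_Iic (a := x))
    integrable_exp_neg_sq_half
  rw [Set.compl_Iic, integral_exp_neg_sq_half] at h2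
  unfold stdGaussCDF
  rw [h1, eq_sub_iff_add_eq, ← mul_add, add_comm, h2]
  exact inv_mul_cancel₀ sqrt_two_pi_pos.ne'

lemma stdGaussCDF_zero : stdGaussCDF 0 = 1 / 2 := by
  have := stdGaussCDF_neg 0
  rw [neg_zero] at this
  linarith

lemma stdGaussCDF_nonneg (x : ℝ) : 0 ≤ stdGaussCDF x :=
  mul_nonneg (by positivity) (MeasureTheory.integral_nonneg fun _ => (Real.exp_pos _).le)

lemma stdGaussCDF_le_one (x : ℝ) : stdGaussCDF x ≤ 1 := by
  have h1 := stdGaussCDF_neg x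
  have h2 := stdGaussCDF_nonneg (-x)
  linarith

lemma stdGaussCDF_sub (a b : ℝ) : stdGaussCDF b - stdGaussCDF a =
    (Real.sqrt (2 * Real.pi))⁻¹ * ∫ t in a..b, Real.exp (-t ^ 2 / 2) := by
  unfold stdGaussCDF
  rw [← mul_sub, intervalIntegral.integral_Iic_sub_Iic]
  · exact integrable_exp_neg_sq_half.integrableOn
  · exact integrable_exp_neg_sq_half.integrableOn

lemma hasDerivAt_stdGaussCDF (x : ℝ) : HasDerivAt stdGaussCDF
    ((Real.sqrt (2 * Real.pi))⁻¹ * Real.exp (-x ^ 2 / 2)) x := by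
  have hc : Continuous fun t : ℝ => Real.exp (-t ^ 2 / 2) := by fun_prop
  have h1 := (hc.integral_hasStrictDerivAt 0 x).hasDerivAt
  have h2 := (h1.const_mul (Real.sqrt (2 * Real.pi))⁻¹).const_add (stdGaussCDF 0)
  refine h2.congr_of_eventuallyEq (Filter.Eventually.of_forall fun y => ?_)
  simp only [← stdGaussCDF_sub]
  ring

lemma stdGaussCDF_mono : Monotone stdGaussCDF :=
  monotone_of_deriv_nonneg (fun x => (hasDerivAt_stdGaussCDF x).differentiableAt) fun x => by
    rw [(hasDerivAt_stdGaussCDF x).deriv]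
    positivity

lemma continuous_stdGaussCDF : Continuous stdGaussCDF :=
  continuous_iff_continuousAt.2 fun x => (hasDerivAt_stdGaussCDF x).continuousAt

/-- The Mills ratio `Φ(w) / φ(w)` of the standard Gaussian. -/
noncomputable def millsRatio (w : ℝ) : ℝ :=
  stdGaussCDF w * (Real.sqrt (2 * Real.pi) * Real.exp (w ^ 2 / 2))

lemma millsRatio_nonneg (w : ℝ) : 0 ≤ millsRatio w :=
  mul_nonneg (stdGaussCDF_nonneg w) (by positivity)

lemma hasDerivAt_millsRatio (w : ℝ) : HasDerivAt millsRatio (1 + w * millsRatio w) w := by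
  have h1 : HasDerivAt (fun w : ℝ => Real.sqrt (2 * Real.pi) * Real.exp (w ^ 2 / 2))
      (Real.sqrt (2 * Real.pi) * (Real.exp (w ^ 2 / 2) * w)) w := by
    have : HasDerivAt (fun w : ℝ => w ^ 2 / 2) w w := by
      have := (hasDerivAt_pow 2 w).div_const 2
      simpa using this
    exact this.exp.const_mul _
  have h2 := (hasDerivAt_stdGaussCDF w).mul h1
  have h3 : Real.exp (-w ^ 2 / 2) * Real.exp (w ^ 2 / 2) = 1 := by
    rw [← Real.exp_add]
    simp [neg_div]
  refine h2.congr_deriv ?_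
  have h4 : (Real.sqrt (2 * Real.pi))⁻¹ * Real.exp (-w ^ 2 / 2) *
      (Real.sqrt (2 * Real.pi) * Real.exp (w ^ 2 / 2)) = 1 := by
    calc _ = ((Real.sqrt (2 * Real.pi))⁻¹ * Real.sqrt (2 * Real.pi)) *
        (Real.exp (-w ^ 2 / 2) * Real.exp (w ^ 2 / 2)) := by ring
      _ = 1 := by rw [h3, inv_mul_cancel₀ sqrt_two_pi_pos.ne', one_mul]
  rw [h4]
  unfold millsRatio
  ring

lemma neg_mul_millsRatio_le {w : ℝ} : -w * millsRatio w ≤ 1 := by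
  have hd : ∀ t : ℝ, HasDerivAt (fun t : ℝ => Real.exp (-t ^ 2 / 2))
      (-t * Real.exp (-t ^ 2 / 2)) t := fun t => by
    have : HasDerivAt (fun t : ℝ => -t ^ 2 / 2) (-t) t := by
      have := ((hasDerivAt_pow 2 t).neg).div_const 2
      simpa [neg_div] using this
    convert this.exp using 1
    ring
  have hi : MeasureTheory.Integrable fun t : ℝ => -t * Real.exp (-t ^ 2 / 2) := by
    have h := (integrable_mul_exp_neg_mul_sq (b := 1 / 2) (by norm_num)).neg
    refine h.congr (Filter.Eventually.of_forall fun t => ?_)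
    simp only [Pi.neg_apply, neg_mul]
    congr 3
    ring
  have ht : Filter.Tendsto (fun t : ℝ => Real.exp (-t ^ 2 / 2)) Filter.atBot (nhds 0) := by
    refine Real.tendsto_exp_atBot.comp ?_
    have : Filter.Tendsto (fun t : ℝ => t ^ 2) Filter.atBot Filter.atTop :=
      ((Filter.tendsto_pow_atTop two_ne_zero).comp Filter.tendsto_neg_atBot_atTop).congr
        fun t => neg_sq t
    have h2 := this.const_mul_atTop (show (0 : ℝ) < 1 / 2 by norm_num)
    have h3 := Filter.tendsto_neg_atTop_atBot.comp h2
    refine h3.congr fun t => ?_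
    simp only [Function.comp]
    ring
  have h1 := MeasureTheory.integral_Iic_of_hasDerivAt_of_tendsto' (a := w)
    (fun t _ => hd t) hi.integrableOn ht
  have h2 : ∫ t in Set.Iic w, -w * Real.exp (-t ^ 2 / 2) ≤
      ∫ t in Set.Iic w, -t * Real.exp (-t ^ 2 / 2) := by
    refine MeasureTheory.setIntegral_mono_on
      (integrable_exp_neg_sq_half.const_mul _).integrableOn hi.integrableOn measurableSet_Iic
      fun t ht => ?_
    have : t ≤ w := ht
    gcongr
  rw [MeasureTheory.integral_const_mul, h1] at h2
  have h3 : Real.exp (-w ^ 2 / 2) * Real.exp (w ^ 2 / 2) = 1 := by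
    rw [← Real.exp_add]
    simp [neg_div]
  have h4 : millsRatio w = (∫ t in Set.Iic w, Real.exp (-t ^ 2 / 2)) * Real.exp (w ^ 2 / 2) := by
    unfold millsRatio stdGaussCDF
    have := sqrt_two_pi_pos.ne'
    field_simp
  rw [h4, ← mul_assoc]
  calc _ ≤ (Real.exp (-w ^ 2 / 2) - 0) * Real.exp (w ^ 2 / 2) := by gcongr
    _ = 1 := by rw [sub_zero, h3]

lemma millsRatio_le_five {w : ℝ} (hw : w ≤ 0) : millsRatio w ≤ 5 := by
  rcases le_total w (-1) with h | h
  · have h1 := neg_mul_millsRatio_le (w := w)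
    have h2 := millsRatio_nonneg w
    nlinarith
  · have h1 : Real.sqrt (2 * Real.pi) ≤ 3 := by
      rw [Real.sqrt_le_left (by norm_num)]
      nlinarith [Real.pi_lt_four]
    have h2 : Real.exp (w ^ 2 / 2) ≤ 3 := by
      have : Real.exp (w ^ 2 / 2) ≤ Real.exp 1 := Real.exp_le_exp.2 (by nlinarith)
      linarith [Real.exp_one_lt_d9]
    have h3 : stdGaussCDF w ≤ 1 / 2 := stdGaussCDF_zero ▸ stdGaussCDF_mono hw
    have h4 := stdGaussCDF_nonneg w
    have h5 : Real.sqrt (2 * Real.pi) * Real.exp (w ^ 2 / 2) ≤ 3 * 3 := by gcongr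
    unfold millsRatio
    calc _ ≤ (1 / 2) * (3 * 3 : ℝ) := by gcongr
      _ ≤ 5 := by norm_num

/-- The solution of Stein's equation for the half line `(-∞, z]`. -/
noncomputable def steinSol (z w : ℝ) : ℝ :=
  if w ≤ z then millsRatio w * stdGaussCDF (-z) else millsRatio (-w) * stdGaussCDF z

/-- The derivative of `steinSol z` away from `z`. -/
noncomputable def steinDeriv (z w : ℝ) : ℝ :=
  w * steinSol z w + (if w ≤ z then 1 else 0) - stdGaussCDF z

lemma steinSol_of_le {z w : ℝ} (h : w ≤ z) :
    steinSol z w = millsRatio w * stdGaussCDF (-z) := if_pos h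

lemma steinSol_of_ge {z w : ℝ} (h : z ≤ w) :
    steinSol z w = millsRatio (-w) * stdGaussCDF z := by
  rcases h.eq_or_lt with rfl | h
  · rw [steinSol_of_le le_rfl]
    unfold millsRatio
    rw [neg_sq]
    ring
  · exact if_neg h.not_ge

lemma steinSol_nonneg (z w : ℝ) : 0 ≤ steinSol z w := by
  unfold steinSol
  split_ifs <;> exact mul_nonneg (millsRatio_nonneg _) (stdGaussCDF_nonneg _)

lemma steinSol_le (z w : ℝ) : steinSol z w ≤ millsRatio (-|w|) := by
  have key : ∀ a b : ℝ, b ≤ -a → millsRatio a * stdGaussCDF b ≤ millsRatio (-a) := by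
    intro a b hab
    have h1 : stdGaussCDF b ≤ stdGaussCDF (-a) := stdGaussCDF_mono hab
    have h2 := stdGaussCDF_le_one a
    have h3 := stdGaussCDF_nonneg b
    unfold millsRatio
    rw [neg_sq]
    have h4 : 0 < Real.sqrt (2 * Real.pi) * Real.exp (a ^ 2 / 2) := by positivity
    calc _ = (stdGaussCDF a * stdGaussCDF b) * (Real.sqrt (2 * Real.pi) * Real.exp (a ^ 2 / 2)) := by
          ring
      _ ≤ (1 * stdGaussCDF (-a)) * (Real.sqrt (2 * Real.pi) * Real.exp (a ^ 2 / 2)) := by gcongr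
      _ = _ := by ring
  have triv : ∀ a b : ℝ, millsRatio a * stdGaussCDF b ≤ millsRatio a := fun a b =>
    mul_le_of_le_one_right (millsRatio_nonneg a) (stdGaussCDF_le_one b)
  rcases le_total w z with h | h
  · rw [steinSol_of_le h]
    rcases le_total w 0 with h0 | h0
    · rw [abs_of_nonpos h0, neg_neg]
      exact triv _ _
    · rw [abs_of_nonneg h0]
      exact key _ _ (neg_le_neg h)
  · rw [steinSol_of_ge h]
    rcases le_total w 0 with h0 | h0
    · rw [abs_of_nonpos h0]
      exact key _ _ (by linarith)
    · rw [abs_of_nonneg h0]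
      exact triv _ _

lemma abs_steinSol_le (z w : ℝ) : |steinSol z w| ≤ 5 := by
  rw [abs_of_nonneg (steinSol_nonneg z w)]
  exact (steinSol_le z w).trans (millsRatio_le_five (by simp))

lemma abs_mul_steinSol_le (z w : ℝ) : |w * steinSol z w| ≤ 1 := by
  rw [abs_mul, abs_of_nonneg (steinSol_nonneg z w)]
  calc _ ≤ |w| * millsRatio (-|w|) := by gcongr; exact steinSol_le z w
    _ = -(-|w|) * millsRatio (-|w|) := by ring
    _ ≤ 1 := neg_mul_millsRatio_le

lemma abs_steinDeriv_le (z w : ℝ) : |steinDeriv z w| ≤ 2 := by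
  have h1 := abs_le.1 (abs_mul_steinSol_le z w)
  have h2 := stdGaussCDF_nonneg z
  have h3 := stdGaussCDF_le_one z
  unfold steinDeriv
  rw [abs_le]
  split_ifs <;> constructor <;> linarith

lemma hasDerivWithinAt_steinSol_Iic {z w : ℝ} (h : w ≤ z) :
    HasDerivWithinAt (steinSol z) (steinDeriv z w) (Set.Iic z) w := by
  have h1 := ((hasDerivAt_millsRatio w).mul_const (stdGaussCDF (-z))).hasDerivWithinAt
    (s := Set.Iic z)
  refine (h1.congr (fun v hv => steinSol_of_le hv) (steinSol_of_le h)).congr_deriv ?_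
  unfold steinDeriv
  rw [steinSol_of_le h, if_pos h, stdGaussCDF_neg]
  ring

lemma hasDerivWithinAt_steinSol_Ici {z w : ℝ} (h : z ≤ w) :
    HasDerivWithinAt (steinSol z) (w * steinSol z w - stdGaussCDF z) (Set.Ici z) w := by
  have h0 : HasDerivAt (fun w => millsRatio (-w)) (-(1 + -w * millsRatio (-w))) w := by
    have := (hasDerivAt_millsRatio (-w)).comp w (hasDerivAt_neg w)
    exact this.congr_deriv (by ring)
  have h1 := (h0.mul_const (stdGaussCDF z)).hasDerivWithinAt (s := Set.Ici z)
  refine (h1.congr (fun v hv => steinSol_of_ge hv) (steinSol_of_ge h)).congr_deriv ?_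
  rw [steinSol_of_ge h]
  ring

lemma steinSol_lipschitz (z v w : ℝ) : |steinSol z v - steinSol z w| ≤ 2 * |v - w| := by
  have hl : ∀ v w, v ≤ z → w ≤ z → |steinSol z v - steinSol z w| ≤ 2 * |v - w| :=
    fun v w hv hw => (convex_Iic z).norm_image_sub_le_of_norm_hasDerivWithin_le
      (fun x hx => hasDerivWithinAt_steinSol_Iic hx) (fun x _ => abs_steinDeriv_le z x) hw hv
  have hr : ∀ v w, z ≤ v → z ≤ w → |steinSol z v - steinSol z w| ≤ 2 * |v - w| :=
    fun v w hv hw => (convex_Ici z).norm_image_sub_le_of_norm_hasDerivWithin_le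
      (fun x hx => hasDerivWithinAt_steinSol_Ici hx) (fun x _ => by
        have h1 := abs_le.1 (abs_mul_steinSol_le z x)
        have h2 := stdGaussCDF_nonneg z
        have h3 := stdGaussCDF_le_one z
        rw [Real.norm_eq_abs, abs_le]
        constructor <;> linarith) hw hv
  rcases le_total v z with h1 | h1 <;> rcases le_total w z with h2 | h2
  · exact hl _ _ h1 h2
  · have a := hl _ _ h1 le_rfl
    have b := hr _ _ le_rfl h2
    have := abs_sub_le (steinSol z v) (steinSol z z) (steinSol z w)
    rw [abs_of_nonpos (sub_nonpos.2 h1)] at a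
    rw [abs_of_nonpos (sub_nonpos.2 h2)] at b
    rw [abs_of_nonpos (by linarith : v - w ≤ 0)]
    linarith
  · have a := hr _ _ h1 le_rfl
    have b := hl _ _ le_rfl h2
    have := abs_sub_le (steinSol z v) (steinSol z z) (steinSol z w)
    rw [abs_of_nonneg (sub_nonneg.2 h1)] at a
    rw [abs_of_nonneg (sub_nonneg.2 h2)] at b
    rw [abs_of_nonneg (by linarith : 0 ≤ v - w)]
    linarith
  · exact hr _ _ h1 h2

lemma abs_mul_steinSol_sub_le (z v w : ℝ) :
    |v * steinSol z v - w * steinSol z w| ≤ (5 + 2 * |w|) * |v - w| := by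
  have h : v * steinSol z v - w * steinSol z w =
      (v - w) * steinSol z v + w * (steinSol z v - steinSol z w) := by ring
  rw [h]
  refine (abs_add_le _ _).trans ?_
  rw [abs_mul, abs_mul]
  have h1 := abs_steinSol_le z v
  have h2 := steinSol_lipschitz z v w
  calc _ ≤ |v - w| * 5 + |w| * (2 * |v - w|) := by gcongr
    _ = _ := by ring

/-- The oscillation bound for `steinDeriv z` at scale `δ`. -/
noncomputable def steinOsc (z δ w : ℝ) : ℝ :=
  (5 + 2 * |w|) * δ + 4 * (if |w - z| ≤ δ then 1 else 0)

lemma abs_steinDeriv_sub_le {z δ w u : ℝ} (hu : |u| ≤ δ) :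
    |steinDeriv z (w + u) - steinDeriv z w| ≤ steinOsc z δ w := by
  have hδ : 0 ≤ δ := (abs_nonneg u).trans hu
  have h0 : 0 ≤ (5 + 2 * |w|) * δ := by positivity
  have h1 := abs_mul_steinSol_sub_le z (w + u) w
  rw [add_sub_cancel_left] at h1
  have h2 : (5 + 2 * |w|) * |u| ≤ (5 + 2 * |w|) * δ := by gcongr
  unfold steinOsc
  by_cases hz : |w - z| ≤ δ
  · rw [if_pos hz]
    have := abs_le.1 (abs_steinDeriv_le z w)
    have := abs_le.1 (abs_steinDeriv_le z (w + u))
    rw [abs_le]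
    constructor <;> linarith
  · rw [if_neg hz]
    have hz' : δ < |w - z| := not_le.1 hz
    have h3 := abs_le.1 hu
    have : (if w + u ≤ z then (1 : ℝ) else 0) = if w ≤ z then 1 else 0 := by
      rcases lt_abs.1 hz' with h | h
      · rw [if_neg (by linarith), if_neg (by linarith)]
      · rw [if_pos (by linarith), if_pos (by linarith)]
    unfold steinDeriv
    rw [this, sub_sub_sub_cancel_right, add_sub_add_right_eq_sub]
    linarith

lemma abs_steinSol_taylor_le {z δ w u : ℝ} (hu : |u| ≤ δ) :
    |steinSol z (w + u) - steinSol z w - u * steinDeriv z w| ≤ |u| * steinOsc z δ w := by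
  have hδ : 0 ≤ δ := (abs_nonneg u).trans hu
  have h0 : 0 ≤ (5 + 2 * |w|) * δ := by positivity
  by_cases hz : |w - z| ≤ δ
  · have h1 := steinSol_lipschitz z (w + u) w
    rw [add_sub_cancel_left] at h1
    have h2 : |u * steinDeriv z w| ≤ |u| * 2 := by
      rw [abs_mul]
      gcongr
      exact abs_steinDeriv_le z w
    have h3 := abs_sub (steinSol z (w + u) - steinSol z w) (u * steinDeriv z w)
    have h4 : |u| * 4 ≤ |u| * steinOsc z δ w := by
      gcongr
      unfold steinOsc
      rw [if_pos hz]
      linarith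
    linarith
  · have hz' : δ < |w - z| := not_le.1 hz
    have h3 := abs_le.1 hu
    have main : ∀ s : Set ℝ, Convex ℝ s → w ∈ s → w + u ∈ s →
        (∀ x ∈ s, HasDerivWithinAt (steinSol z) (steinDeriv z x) s x) →
        |steinSol z (w + u) - steinSol z w - u * steinDeriv z w| ≤ |u| * steinOsc z δ w := by
      intro s hs hw hwu hd
      have hseg : Convex ℝ (s ∩ Set.Icc (w - |u|) (w + |u|)) := hs.inter (convex_Icc _ _)
      have hd' : ∀ x ∈ s ∩ Set.Icc (w - |u|) (w + |u|),
          HasDerivWithinAt (fun x => steinSol z x - x * steinDeriv z w)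
            (steinDeriv z x - 1 * steinDeriv z w) (s ∩ Set.Icc (w - |u|) (w + |u|)) x :=
        fun x hx => ((hd x hx.1).mono Set.inter_subset_left).sub
          ((hasDerivWithinAt_id x _).mul_const _)
      have := hseg.norm_image_sub_le_of_norm_hasDerivWithin_le (C := steinOsc z δ w) hd'
        (fun x hx => by
          have hx2 : |x - w| ≤ δ := by
            rw [abs_le]
            constructor <;> linarith [hx.2.1, hx.2.2]
          have := abs_steinDeriv_sub_le (z := z) (w := w) hx2
          rwa [add_sub_cancel, ← one_mul (steinDeriv z w)] at this)
        (x := w) (y := w + u) ⟨hw, by constructor <;> linarith [abs_nonneg u]⟩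
        ⟨hwu, by constructor <;> linarith [neg_abs_le u, le_abs_self u]⟩
      rw [Real.norm_eq_abs, Real.norm_eq_abs, add_sub_cancel_left] at this
      calc _ = |steinSol z (w + u) - (w + u) * steinDeriv z w -
            (steinSol z w - w * steinDeriv z w)| := by congr 1; ring
        _ ≤ _ := by rw [mul_comm |u|]; exact this
    rcases lt_abs.1 hz' with h | h
    · refine main (Set.Ioi z) (convex_Ioi z) (show z < w by linarith)
        (show z < w + u by linarith) fun x hx => ?_
      have hx' : z < x := hx
      have := (hasDerivWithinAt_steinSol_Ici hx'.le).mono Set.Ioi_subset_Ici_self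
      refine this.congr_deriv ?_
      unfold steinDeriv
      rw [if_neg hx'.not_ge, add_zero]
    · exact main (Set.Iic z) (convex_Iic z) (show w ≤ z by linarith)
        (show w + u ≤ z by linarith) fun x hx => hasDerivWithinAt_steinSol_Iic hx

section ProductExpectation

variable {ι : Type} [Fintype ι] [DecidableEq ι]

/-- Expectation of `g` under the product of the weights `p i`. -/
noncomputable def prodExp (p : ι → Y → ℝ) (g : (ι → Y) → ℝ) : ℝ :=
  ∑ y, (∏ i, p i (y i)) * g y

variable {p : ι → Y → ℝ}

lemma prodExp_add (g h : (ι → Y) → ℝ) :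
    prodExp p (fun y => g y + h y) = prodExp p g + prodExp p h := by
  simp only [prodExp, mul_add, Finset.sum_add_distrib]

lemma prodExp_sub (g h : (ι → Y) → ℝ) :
    prodExp p (fun y => g y - h y) = prodExp p g - prodExp p h := by
  simp only [prodExp, mul_sub, Finset.sum_sub_distrib]

lemma prodExp_const_mul (c : ℝ) (g : (ι → Y) → ℝ) :
    prodExp p (fun y => c * g y) = c * prodExp p g := by
  simp only [prodExp, Finset.mul_sum]
  exact Finset.sum_congr rfl fun _ _ => by ring

lemma prodExp_sum {κ : Type} (s : Finset κ) (g : κ → (ι → Y) → ℝ) :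
    prodExp p (fun y => ∑ k ∈ s, g k y) = ∑ k ∈ s, prodExp p (g k) := by
  simp only [prodExp, Finset.mul_sum]
  exact Finset.sum_comm

lemma prodExp_mono (hp : ∀ i a, 0 ≤ p i a) {g h : (ι → Y) → ℝ} (hgh : ∀ y, g y ≤ h y) :
    prodExp p g ≤ prodExp p h :=
  Finset.sum_le_sum fun y _ =>
    mul_le_mul_of_nonneg_left (hgh y) (Finset.prod_nonneg fun i _ => hp i _)

lemma abs_prodExp_le (hp : ∀ i a, 0 ≤ p i a) (g : (ι → Y) → ℝ) :
    |prodExp p g| ≤ prodExp p fun y => |g y| := by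
  refine (Finset.abs_sum_le_sum_abs _ _).trans (Finset.sum_le_sum fun y _ => ?_)
  rw [abs_mul, abs_of_nonneg (Finset.prod_nonneg fun i _ => hp i _)]

lemma prodExp_const (hp1 : ∀ i, ∑ a, p i a = 1) (c : ℝ) : prodExp p (fun _ => c) = c := by
  unfold prodExp
  rw [← Finset.sum_mul, ← Fintype.prod_sum]
  simp [hp1]

lemma prodExp_indep (hp1 : ∀ i, ∑ a, p i a = 1) (i : ι) (h : Y → ℝ) (g : (ι → Y) → ℝ)
    (hg : ∀ y y', (∀ j, j ≠ i → y j = y' j) → g y = g y') :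
    prodExp p (fun y => h (y i) * g y) = (∑ a, p i a * h a) * prodExp p g := by
  rcases isEmpty_or_nonempty Y with hY | ⟨⟨a₀⟩⟩
  · have := hp1 i
    simp at this
  have key : ∀ k : Y → ℝ, prodExp p (fun y => k (y i) * g y) =
      (∑ a, p i a * k a) * ∑ b : {j // j ≠ i} → Y, (∏ j : {j // j ≠ i}, p j (b j)) *
        g ((Equiv.funSplitAt i Y).symm (a₀, b)) := by
    intro k
    unfold prodExp
    rw [← (Equiv.funSplitAt i Y).symm.sum_comp, Fintype.sum_prod_type, Finset.sum_mul]
    refine Finset.sum_congr rfl fun a _ => ?_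
    rw [Finset.mul_sum]
    refine Finset.sum_congr rfl fun b _ => ?_
    have h1 : g ((Equiv.funSplitAt i Y).symm (a, b)) =
        g ((Equiv.funSplitAt i Y).symm (a₀, b)) := by
      refine hg _ _ fun j hj => ?_
      simp [Equiv.funSplitAt, hj]
    have h2 : ∏ j, p j ((Equiv.funSplitAt i Y).symm (a, b) j) = p i a * ∏ j : {j // j ≠ i}, p j (b j) := by
      rw [Fintype.prod_eq_mul_prod_subtype_ne _ i]
      congr 1
      · simp [Equiv.funSplitAt]
      · refine Finset.prod_congr rfl fun j _ => ?_
        simp [Equiv.funSplitAt, j.2]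
    beta_reduce
    rw [h1, h2]
    simp only [Equiv.funSplitAt, Equiv.piSplitAt_symm_apply, dite_true]
    ring
  have h1 := key fun _ => 1
  simp only [one_mul, mul_one, hp1] at h1
  rw [key h, ← h1]

lemma prodExp_eval (hp1 : ∀ i, ∑ a, p i a = 1) (i : ι) (h : Y → ℝ) :
    prodExp p (fun y => h (y i)) = ∑ a, p i a * h a := by
  have := prodExp_indep hp1 i h (fun _ => 1) fun _ _ _ => rfl
  simpa [prodExp_const hp1] using this

lemma prodExp_sum_mul_eq (hp1 : ∀ i, ∑ a, p i a = 1) (u : ι → Y → ℝ)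
    (hu0 : ∀ i, ∑ a, p i a * u i a = 0) (F : ℝ → ℝ) :
    prodExp p (fun y => (∑ i, u i (y i)) * F (∑ i, u i (y i))) =
      ∑ i, prodExp p (fun y => u i (y i) *
        (F (∑ j, u j (y j)) - F (∑ j ∈ univ.erase i, u j (y j)))) := by
  simp only [Finset.sum_mul]
  rw [prodExp_sum]
  refine Finset.sum_congr rfl fun i _ => ?_
  simp only [mul_sub]
  rw [prodExp_sub, prodExp_indep hp1 i (u i) (fun y => F (∑ j ∈ univ.erase i, u j (y j))), hu0,
    zero_mul, sub_zero]
  intro y y' hyy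
  congr 1
  exact Finset.sum_congr rfl fun j hj => by rw [hyy j (Finset.ne_of_mem_erase hj)]

lemma prodExp_sq_sum (hp1 : ∀ i, ∑ a, p i a = 1) (u : ι → Y → ℝ)
    (hu0 : ∀ i, ∑ a, p i a * u i a = 0) :
    prodExp p (fun y => (∑ i, u i (y i)) ^ 2) = ∑ i, ∑ a, p i a * u i a ^ 2 := by
  have h := prodExp_sum_mul_eq hp1 u hu0 id
  simp only [id] at h
  simp only [sq]
  rw [h]
  refine Finset.sum_congr rfl fun i _ => ?_
  rw [← prodExp_eval hp1 i fun a => u i a * u i a]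
  congr 1
  ext y
  rw [← Finset.add_sum_erase univ (fun j => u j (y j)) (Finset.mem_univ i)]
  ring

variable (hp : ∀ i a, 0 ≤ p i a) (hp1 : ∀ i, ∑ a, p i a = 1) {u : ι → Y → ℝ}
  (hu0 : ∀ i, ∑ a, p i a * u i a = 0) (hu1 : ∑ i, ∑ a, p i a * u i a ^ 2 = 1)
  {δ : ℝ} (hδ : 0 < δ) (hub : ∀ i a, |u i a| ≤ δ)

include hp hp1 hu0 hu1

lemma prodExp_abs_sum_le_one : prodExp p (fun y => |∑ i, u i (y i)|) ≤ 1 := by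
  have h1 := prodExp_sq_sum hp1 u hu0
  rw [hu1] at h1
  calc _ ≤ prodExp p (fun y => (1 / 2) * (1 + (∑ i, u i (y i)) ^ 2)) :=
        prodExp_mono hp fun y => by
          rw [← sq_abs]
          nlinarith [sq_nonneg (|∑ i, u i (y i)| - 1)]
    _ = 1 := by
        rw [prodExp_const_mul, prodExp_add, prodExp_const hp1, h1]
        norm_num

include hδ hub

omit hu0 in
lemma prodExp_abs_one_sub_sum_sq_le :
    prodExp p (fun y => |1 - ∑ i, u i (y i) ^ 2|) ≤ δ := by
  set s : ι → ℝ := fun i => ∑ a, p i a * u i a ^ 2 with hs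
  set v : ι → Y → ℝ := fun i a => u i a ^ 2 - s i with hv
  have hv0 : ∀ i, ∑ a, p i a * v i a = 0 := fun i => by
    simp only [hv, mul_sub, Finset.sum_sub_distrib, ← Finset.sum_mul, hp1, one_mul]
    simp [hs]
  have h1 := prodExp_sq_sum hp1 v hv0
  have h2 : ∀ i, ∑ a, p i a * v i a ^ 2 ≤ δ ^ 2 * s i := fun i => by
    have e : ∑ a, p i a * v i a ^ 2 = ∑ a, p i a * u i a ^ 4 - s i ^ 2 := by
      have : ∀ a, p i a * v i a ^ 2 =
          p i a * u i a ^ 4 - 2 * s i * (p i a * u i a ^ 2) + s i ^ 2 * p i a := fun a => by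
        simp only [hv]
        ring
      simp only [this, Finset.sum_add_distrib, Finset.sum_sub_distrib, ← Finset.mul_sum, hp1]
      change _ - 2 * s i * s i + _ = _
      ring
    have e2 : ∑ a, p i a * u i a ^ 4 ≤ δ ^ 2 * s i := by
      rw [hs, Finset.mul_sum]
      refine Finset.sum_le_sum fun a _ => ?_
      have : u i a ^ 2 ≤ δ ^ 2 := sq_le_sq' (abs_le.1 (hub i a)).1 (abs_le.1 (hub i a)).2
      have h3 := mul_le_mul_of_nonneg_left this (mul_nonneg (hp i a) (sq_nonneg (u i a)))
      nlinarith
    nlinarith [sq_nonneg (s i)]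
  have h3 : prodExp p (fun y => (∑ i, v i (y i)) ^ 2) ≤ δ ^ 2 := by
    rw [h1]
    calc _ ≤ ∑ i, δ ^ 2 * s i := Finset.sum_le_sum fun i _ => h2 i
      _ = δ ^ 2 := by rw [← Finset.mul_sum, hu1, mul_one]
  have h4 : ∀ y : ι → Y, ∑ i, v i (y i) = ∑ i, u i (y i) ^ 2 - 1 := fun y => by
    simp only [hv, Finset.sum_sub_distrib]
    rw [hs, hu1]
  calc _ ≤ prodExp p (fun y => (1 / (2 * δ)) * (δ ^ 2 + (∑ i, v i (y i)) ^ 2)) :=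
        prodExp_mono hp fun y => by
          rw [h4, one_div, inv_mul_eq_div, le_div_iff₀ (by positivity), abs_sub_comm, ← sq_abs (_ - 1)]
          nlinarith [sq_nonneg (δ - |∑ i, u i (y i) ^ 2 - 1|)]
    _ = 1 / (2 * δ) * (δ ^ 2 + prodExp p (fun y => (∑ i, v i (y i)) ^ 2)) := by
        rw [prodExp_const_mul, prodExp_add, prodExp_const hp1]
    _ ≤ 1 / (2 * δ) * (δ ^ 2 + δ ^ 2) := by gcongr
    _ = δ := by field_simp; norm_num

/-- A concentration inequality for sums of bounded independent variables. -/
lemma prodExp_concentration {f g : ℝ → ℝ} {A : ℝ} (hf : ∀ w, |f w| ≤ A)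
    (hg0 : ∀ w, 0 ≤ g w) (hg1 : ∀ w, g w ≤ 1)
    (hfg : ∀ w t, |t| ≤ δ → g w * t ^ 2 ≤ t * (f w - f (w - t))) :
    prodExp p (fun y => g (∑ i, u i (y i))) ≤ A + δ := by
  have hA : 0 ≤ A := (abs_nonneg _).trans (hf 0)
  have h1 := prodExp_sum_mul_eq hp1 u hu0 f
  have h2 : prodExp p (fun y => (∑ i, u i (y i)) * f (∑ i, u i (y i))) ≤ A := by
    calc _ ≤ prodExp p (fun y => A * |∑ i, u i (y i)|) := prodExp_mono hp fun y => by
          refine (le_abs_self _).trans ?_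
          rw [abs_mul, mul_comm]
          gcongr
          exact hf _
      _ ≤ A * 1 := by
          rw [prodExp_const_mul]
          gcongr
          exact prodExp_abs_sum_le_one hp hp1 hu0 hu1
      _ = A := mul_one A
  have h3 : prodExp p (fun y => g (∑ i, u i (y i)) * ∑ i, u i (y i) ^ 2) ≤ A := by
    refine le_trans ?_ h2
    rw [h1]
    simp only [Finset.mul_sum]
    rw [prodExp_sum]
    refine Finset.sum_le_sum fun i _ => prodExp_mono hp fun y => ?_
    have := hfg (∑ j, u j (y j)) (u i (y i)) (hub i _)
    rw [← Finset.add_sum_erase univ (fun j => u j (y j)) (Finset.mem_univ i)] at this ⊢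
    rwa [add_sub_cancel_left] at this
  calc _ ≤ prodExp p (fun y => g (∑ i, u i (y i)) * ∑ i, u i (y i) ^ 2 +
        |1 - ∑ i, u i (y i) ^ 2|) := prodExp_mono hp fun y => by
          have a1 := hg0 (∑ i, u i (y i))
          have a2 := hg1 (∑ i, u i (y i))
          have a3 := le_abs_self (1 - ∑ i, u i (y i) ^ 2)
          have a4 := abs_nonneg (1 - ∑ i, u i (y i) ^ 2)
          nlinarith
    _ ≤ A + δ := by
        rw [prodExp_add]
        exact add_le_add h3 (prodExp_abs_one_sub_sum_sq_le hp hp1 hu1 hδ hub)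

lemma prodExp_exp_tail_le (z : ℝ) :
    prodExp p (fun y => if ∑ i, u i (y i) ≤ z then
      Real.exp ((∑ i, u i (y i) - z) / δ) else 0) ≤ 9 * δ := by
  have h := prodExp_concentration hp hp1 hu0 hu1 hδ hub
    (f := fun w => Real.exp 1 * δ * Real.exp ((min w (z + δ) - z) / δ))
    (g := fun w => if w ≤ z then Real.exp ((w - z) / δ) else 0)
    (A := 8 * δ) ?_ ?_ ?_ ?_
  · linarith
  · intro w
    rw [abs_of_nonneg (by positivity)]
    have h1 : Real.exp ((min w (z + δ) - z) / δ) ≤ Real.exp 1 := by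
      refine Real.exp_le_exp.2 ?_
      rw [div_le_one hδ]
      linarith [min_le_right w (z + δ)]
    have h2 := Real.exp_one_lt_d9
    have h3 := Real.exp_pos 1
    calc _ ≤ Real.exp 1 * δ * Real.exp 1 := by gcongr
      _ = (Real.exp 1 * Real.exp 1) * δ := by ring
      _ ≤ 8 * δ := by
        gcongr
        nlinarith
  · intro w
    split_ifs <;> positivity
  · intro w
    split_ifs with hw
    · rw [Real.exp_le_one_iff]
      exact div_nonpos_of_nonpos_of_nonneg (by linarith) hδ.le
    · exact zero_le_one
  · intro w t ht
    have ht' := abs_le.1 ht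
    split_ifs with hw
    · rw [min_eq_left (by linarith), min_eq_left (by linarith)]
      have e1 : Real.exp ((w - t - z) / δ) = Real.exp ((w - z) / δ) * Real.exp (-(t / δ)) := by
        rw [← Real.exp_add]
        congr 1
        field_simp
        ring
      rw [e1]
      set s := t / δ with hs
      have hts : t = s * δ := by rw [hs]; field_simp
      have hs1 : |s| ≤ 1 := by
        rw [hs, abs_div, abs_of_pos hδ, div_le_one hδ]
        exact ht
      have hs' := abs_le.1 hs1
      have key : s ^ 2 ≤ Real.exp 1 * (s * (1 - Real.exp (-s))) := by
        have e2 : 1 ≤ Real.exp 1 := Real.one_le_exp (by norm_num)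
        rcases le_total 0 s with h0 | h0
        · have a1 : s * Real.exp (-s) ≤ 1 - Real.exp (-s) := by
            have := Real.add_one_le_exp s
            have b : Real.exp s * Real.exp (-s) = 1 := by rw [← Real.exp_add]; simp
            nlinarith [Real.exp_pos (-s)]
          have a2 : 1 ≤ Real.exp 1 * Real.exp (-s) := by
            rw [← Real.exp_add]
            exact Real.one_le_exp (by linarith)
          calc s ^ 2 = s ^ 2 * 1 := by ring
            _ ≤ s ^ 2 * (Real.exp 1 * Real.exp (-s)) := by gcongr
            _ = Real.exp 1 * (s * (s * Real.exp (-s))) := by ring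
            _ ≤ _ := by gcongr
        · have a1 : -s ≤ Real.exp (-s) - 1 := by linarith [Real.add_one_le_exp (-s)]
          have a2 : s ^ 2 ≤ s * (1 - Real.exp (-s)) := by nlinarith
          nlinarith [sq_nonneg s]
      have hpos := Real.exp_pos ((w - z) / δ)
      rw [hts]
      calc _ = (Real.exp ((w - z) / δ) * δ ^ 2) * s ^ 2 := by ring
        _ ≤ (Real.exp ((w - z) / δ) * δ ^ 2) * (Real.exp 1 * (s * (1 - Real.exp (-s)))) := by
          gcongr
        _ = _ := by ring
    · rw [zero_mul]
      rcases le_total 0 t with h0 | h0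
      · refine mul_nonneg h0 (sub_nonneg.2 ?_)
        have : min (w - t) (z + δ) ≤ min w (z + δ) := min_le_min_right _ (by linarith)
        gcongr
      · refine mul_nonneg_of_nonpos_of_nonpos h0 (sub_nonpos.2 ?_)
        have : min w (z + δ) ≤ min (w - t) (z + δ) := min_le_min_right _ (by linarith)
        gcongr

lemma prodExp_window_le (z : ℝ) :
    prodExp p (fun y => if |∑ i, u i (y i) - z| ≤ 2 * δ then 1 else 0) ≤ 4 * δ := by
  have h := prodExp_concentration hp hp1 hu0 hu1 hδ hub
    (f := fun w => max (-(3 * δ)) (min (w - z) (3 * δ)))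
    (g := fun w => if |w - z| ≤ 2 * δ then 1 else 0)
    (A := 3 * δ) ?_ ?_ ?_ ?_
  · linarith
  · intro w
    rw [abs_le]
    exact ⟨le_max_left _ _, max_le (by linarith) (min_le_right _ _)⟩
  · intro w
    split_ifs <;> norm_num
  · intro w
    split_ifs <;> norm_num
  · intro w t ht
    have ht' := abs_le.1 ht
    split_ifs with hw
    · have hw' := abs_le.1 hw
      rw [min_eq_left (by linarith), min_eq_left (by linarith), max_eq_right (by linarith),
        max_eq_right (by linarith)]
      linarith
    · rw [zero_mul]
      rcases le_total 0 t with h0 | h0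
      · refine mul_nonneg h0 (sub_nonneg.2 ?_)
        gcongr
        linarith
      · refine mul_nonneg_of_nonpos_of_nonpos h0 (sub_nonpos.2 ?_)
        gcongr
        linarith

/-- A Berry–Esseen bound for sums of bounded independent variables. -/
lemma prodExp_berryEsseen (hδ1 : δ ≤ 1) (z : ℝ) :
    |prodExp p (fun y => if ∑ i, u i (y i) ≤ z then 1 else 0) - stdGaussCDF z| ≤ 50 * δ := by
  set S : (ι → Y) → ℝ := fun y => ∑ i, u i (y i) with hS
  set T : ι → (ι → Y) → ℝ := fun i y => ∑ j ∈ univ.erase i, u j (y j) with hT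
  have hST : ∀ i y, S y = T i y + u i (y i) := fun i y =>
    (Finset.sum_erase_add univ (fun j => u j (y j)) (Finset.mem_univ i)).symm
  set R : ℝ → ℝ := fun w => (5 + 2 * (|w| + δ)) * δ + 4 * (if |w - z| ≤ 2 * δ then 1 else 0) with hR
  have hTR : ∀ i y, steinOsc z δ (T i y) ≤ R (S y) := fun i y => by
    have hb := abs_le.1 (hub i (y i))
    unfold steinOsc
    simp only [hR]
    have h1 : |T i y| ≤ |S y| + δ := by
      have : T i y = S y - u i (y i) := by rw [hST i y]; ring
      rw [this]
      exact (abs_sub _ _).trans (by linarith [hub i (y i)])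
    have h2 : (if |T i y - z| ≤ δ then (1 : ℝ) else 0) ≤ if |S y - z| ≤ 2 * δ then 1 else 0 := by
      by_cases hc : |T i y - z| ≤ δ
      · rw [if_pos hc, if_pos]
        rw [hST i y]
        have := abs_le.1 hc
        rw [abs_le]
        constructor <;> linarith
      · rw [if_neg hc]
        split_ifs <;> norm_num
    have h3 : (5 + 2 * |T i y|) * δ ≤ (5 + 2 * (|S y| + δ)) * δ := by gcongr
    linarith
  have hER : prodExp p (fun y => R (S y)) ≤ 25 * δ := by
    simp only [hR]
    rw [prodExp_add, prodExp_const_mul]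
    have h1 := prodExp_window_le hp hp1 hu0 hu1 hδ hub z
    have h2 := prodExp_abs_sum_le_one hp hp1 hu0 hu1
    have h3 : prodExp p (fun y => (5 + 2 * (|S y| + δ)) * δ) =
        (5 + 2 * δ) * δ + 2 * δ * prodExp p (fun y => |S y|) := by
      rw [← prodExp_const_mul, ← prodExp_const hp1 ((5 + 2 * δ) * δ), ← prodExp_add]
      congr 1
      ext y
      ring
    rw [h3]
    nlinarith
  have hTindep : ∀ (i : ι) (h : Y → ℝ) (G : ℝ → ℝ), prodExp p (fun y => h (y i) * G (T i y)) =
      (∑ a, p i a * h a) * prodExp p (fun y => G (T i y)) := fun i h G =>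
    prodExp_indep hp1 i h _ fun y y' hyy => by
      simp only [hT]
      congr 1
      exact Finset.sum_congr rfl fun j hj => by rw [hyy j (Finset.ne_of_mem_erase hj)]
  have hs : ∀ i, 0 ≤ ∑ a, p i a * u i a ^ 2 := fun i =>
    Finset.sum_nonneg fun a _ => mul_nonneg (hp i a) (sq_nonneg _)
  have main : ∀ i, |prodExp p (fun y => u i (y i) * (steinSol z (S y) - steinSol z (T i y))) -
      (∑ a, p i a * u i a ^ 2) * prodExp p (fun y => steinDeriv z (S y))| ≤
      (∑ a, p i a * u i a ^ 2) * (50 * δ) := by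
    intro i
    set s := ∑ a, p i a * u i a ^ 2
    have e1 := hTindep i (fun a => u i a ^ 2) (steinDeriv z)
    have e2 := hTindep i (fun a => u i a ^ 2) (steinOsc z δ)
    have e3 : prodExp p (fun y => steinOsc z δ (T i y)) ≤ 25 * δ :=
      (prodExp_mono hp (hTR i)).trans hER
    have b1 : |prodExp p (fun y => u i (y i) * (steinSol z (S y) - steinSol z (T i y))) -
        s * prodExp p (fun y => steinDeriv z (T i y))| ≤ s * (25 * δ) := by
      rw [← e1, ← prodExp_sub]
      refine (abs_prodExp_le hp _).trans (le_trans ?_ (mul_le_mul_of_nonneg_left e3 (hs i)))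
      rw [← e2]
      refine prodExp_mono hp fun y => ?_
      have := abs_steinSol_taylor_le (z := z) (w := T i y) (hub i (y i))
      rw [← hST i y] at this
      calc _ = |u i (y i)| * |steinSol z (S y) - steinSol z (T i y) -
            u i (y i) * steinDeriv z (T i y)| := by
            rw [← abs_mul]
            congr 1
            ring
        _ ≤ |u i (y i)| * (|u i (y i)| * steinOsc z δ (T i y)) := by gcongr
        _ = _ := by rw [← mul_assoc, abs_mul_abs_self, sq]
    have b2 : |prodExp p (fun y => steinDeriv z (T i y)) -
        prodExp p (fun y => steinDeriv z (S y))| ≤ 25 * δ := by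
      rw [← prodExp_sub]
      refine (abs_prodExp_le hp _).trans (le_trans (prodExp_mono hp fun y => ?_) e3)
      have := abs_steinDeriv_sub_le (z := z) (w := T i y) (hub i (y i))
      rwa [← hST i y, abs_sub_comm] at this
    have b3 : |s * prodExp p (fun y => steinDeriv z (T i y)) -
        s * prodExp p (fun y => steinDeriv z (S y))| ≤ s * (25 * δ) := by
      rw [← mul_sub, abs_mul, abs_of_nonneg (hs i)]
      exact mul_le_mul_of_nonneg_left b2 (hs i)
    have := abs_sub_le (prodExp p (fun y => u i (y i) * (steinSol z (S y) - steinSol z (T i y))))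
      (s * prodExp p (fun y => steinDeriv z (T i y))) (s * prodExp p (fun y => steinDeriv z (S y)))
    linarith
  have h1 := prodExp_sum_mul_eq hp1 u hu0 (steinSol z)
  have h2 : |prodExp p (fun y => S y * steinSol z (S y)) -
      prodExp p (fun y => steinDeriv z (S y))| ≤ 50 * δ := by
    have e : prodExp p (fun y => steinDeriv z (S y)) =
        ∑ i, (∑ a, p i a * u i a ^ 2) * prodExp p (fun y => steinDeriv z (S y)) := by
      rw [← Finset.sum_mul, hu1, one_mul]
    rw [h1, e, ← Finset.sum_sub_distrib]
    refine (Finset.abs_sum_le_sum_abs _ _).trans ((Finset.sum_le_sum fun i _ => main i).trans ?_)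
    rw [← Finset.sum_mul, hu1, one_mul]
  have h3 : prodExp p (fun y => steinDeriv z (S y)) = prodExp p (fun y => S y * steinSol z (S y)) +
      prodExp p (fun y => if S y ≤ z then 1 else 0) - stdGaussCDF z := by
    rw [← prodExp_add, ← prodExp_const hp1 (stdGaussCDF z), ← prodExp_sub]
    rfl
  rw [h3, abs_sub_comm] at h2
  convert h2 using 2
  ring

end ProductExpectation

section LogLikelihoodSums

variable {ι : Type} [Fintype ι] [DecidableEq ι] {p : ι → Y → ℝ}

/-- The sum of the variances of `h` under the weights `p i`. -/
noncomputable def sumVar (p : ι → Y → ℝ) (h : Y → ℝ) : ℝ :=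
  ∑ i, ∑ a, p i a * (h a - ∑ b, p i b * h b) ^ 2

lemma sum_weight_mul_le {q : Y → ℝ} (hq : ∀ a, 0 ≤ q a) (hq1 : ∑ a, q a = 1)
    {h : Y → ℝ} {B : ℝ} (hB : ∀ a, |h a| ≤ B) : |∑ a, q a * h a| ≤ B := by
  refine (Finset.abs_sum_le_sum_abs _ _).trans ?_
  calc _ ≤ ∑ a, q a * B := Finset.sum_le_sum fun a _ => by
        rw [abs_mul, abs_of_nonneg (hq a)]
        exact mul_le_mul_of_nonneg_left (hB a) (hq a)
    _ = B := by rw [← Finset.sum_mul, hq1, one_mul]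

lemma abs_sub_mean_le {q : Y → ℝ} (hq : ∀ a, 0 ≤ q a) (hq1 : ∑ a, q a = 1)
    {h : Y → ℝ} {B : ℝ} (hB : ∀ a, |h a| ≤ B) (a : Y) :
    |h a - ∑ b, q b * h b| ≤ 2 * B := by
  have h1 := sum_weight_mul_le hq hq1 hB
  exact (abs_sub _ _).trans (by linarith [hB a])

variable (hp : ∀ i a, 0 ≤ p i a) (hp1 : ∀ i, ∑ a, p i a = 1) {h : Y → ℝ} {B : ℝ}
  (hB : ∀ a, |h a| ≤ B)

include hp hp1 hB

lemma prodExp_normalized (hv : 0 < sumVar p h) :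
    (∀ i, ∑ a, p i a * ((h a - ∑ b, p i b * h b) / Real.sqrt (sumVar p h)) = 0) ∧
    (∑ i, ∑ a, p i a * ((h a - ∑ b, p i b * h b) / Real.sqrt (sumVar p h)) ^ 2 = 1) ∧
    (∀ i a, |(h a - ∑ b, p i b * h b) / Real.sqrt (sumVar p h)| ≤
      2 * B / Real.sqrt (sumVar p h)) := by
  have hs := Real.sqrt_pos.2 hv
  refine ⟨fun i => ?_, ?_, fun i a => ?_⟩
  · simp only [← mul_div_assoc]
    rw [← Finset.sum_div]
    simp only [mul_sub, Finset.sum_sub_distrib, ← Finset.sum_mul, hp1]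
    simp
  · simp only [div_pow, Real.sq_sqrt hv.le, ← mul_div_assoc]
    simp only [← Finset.sum_div]
    exact div_self hv.ne'
  · rw [abs_div, abs_of_pos hs]
    gcongr
    exact abs_sub_mean_le (hp i) (hp1 i) hB a

lemma prodExp_le_lower_tail (hB0 : 0 < B) (hv : 0 < sumVar p h) (L : ℝ) :
    stdGaussCDF ((L - ∑ i, ∑ a, p i a * h a) / Real.sqrt (sumVar p h)) -
      100 * B / Real.sqrt (sumVar p h) ≤
      prodExp p (fun y => if ∑ i, h (y i) ≤ L then 1 else 0) := by
  have hs := Real.sqrt_pos.2 hv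
  obtain ⟨h0, h1, h2⟩ := prodExp_normalized hp hp1 hB hv
  set s := Real.sqrt (sumVar p h)
  by_cases hδ : 2 * B / s ≤ 1
  · have := prodExp_berryEsseen hp hp1 h0 h1 (by positivity) h2 hδ
      ((L - ∑ i, ∑ a, p i a * h a) / s)
    have e : ∀ y : ι → Y, (∑ i, (h (y i) - ∑ b, p i b * h b) / s ≤
        (L - ∑ i, ∑ a, p i a * h a) / s) ↔ ∑ i, h (y i) ≤ L := fun y => by
      rw [← Finset.sum_div, div_le_div_iff_of_pos_right hs, Finset.sum_sub_distrib]
      simp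
    simp only [e] at this
    have e2 : 50 * (2 * B / s) = 100 * B / s := by ring
    rw [e2] at this
    linarith [(abs_le.1 this).1]
  · have h3 := stdGaussCDF_le_one ((L - ∑ i, ∑ a, p i a * h a) / s)
    have h4 : 0 ≤ prodExp p (fun y => if ∑ i, h (y i) ≤ L then 1 else 0) := by
      refine (prodExp_const hp1 (0 : ℝ)).symm.le.trans (prodExp_mono hp fun y => ?_)
      split_ifs <;> norm_num
    have e2 : 50 * (2 * B / s) = 100 * B / s := by ring
    linarith

lemma prodExp_exp_sub_le (hB0 : 1 / 2 ≤ B) (hv : 0 < sumVar p h) (L : ℝ) :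
    prodExp p (fun y => if ∑ i, h (y i) ≤ L then Real.exp (∑ i, h (y i) - L) else 0) ≤
      18 * B / Real.sqrt (sumVar p h) := by
  have hs := Real.sqrt_pos.2 hv
  obtain ⟨h0, h1, h2⟩ := prodExp_normalized hp hp1 hB hv
  set s := Real.sqrt (sumVar p h)
  have := prodExp_exp_tail_le hp hp1 h0 h1 (by positivity) h2
    ((L - ∑ i, ∑ a, p i a * h a) / s)
  have e2 : 9 * (2 * B / s) = 18 * B / s := by ring
  rw [e2] at this
  refine le_trans (prodExp_mono hp fun y => ?_) this
  have e : ∑ i, (h (y i) - ∑ b, p i b * h b) / s = (∑ i, h (y i) - ∑ i, ∑ a, p i a * h a) / s := by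
    rw [← Finset.sum_div, Finset.sum_sub_distrib]
  simp only [e, div_le_div_iff_of_pos_right hs, sub_le_sub_iff_right]
  split_ifs with hy
  · refine Real.exp_le_exp.2 ?_
    rw [← sub_div, div_div_div_cancel_right₀ hs.ne', sub_sub_sub_cancel_right,
      le_div_iff₀ (by positivity)]
    nlinarith
  · exact le_rfl

lemma prodExp_upper_tail_le {t : ℝ} (ht : 0 < t) :
    prodExp p (fun y => if ∑ i, h (y i) ≤ (∑ i, ∑ a, p i a * h a) + t then 0 else 1) ≤
      Fintype.card ι * (2 * B) ^ 2 / t ^ 2 := by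
  have h0 : ∀ i, ∑ a, p i a * (h a - ∑ b, p i b * h b) = 0 := fun i => by
    simp only [mul_sub, Finset.sum_sub_distrib, ← Finset.sum_mul, hp1]
    simp
  have h1 := prodExp_sq_sum hp1 (fun i a => h a - ∑ b, p i b * h b) h0
  have h2 : ∑ i, ∑ a, p i a * (h a - ∑ b, p i b * h b) ^ 2 ≤ Fintype.card ι * (2 * B) ^ 2 := by
    calc _ ≤ ∑ _i : ι, (2 * B) ^ 2 := Finset.sum_le_sum fun i _ => by
          calc _ ≤ ∑ a, p i a * (2 * B) ^ 2 := Finset.sum_le_sum fun a _ => by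
                refine mul_le_mul_of_nonneg_left ?_ (hp i a)
                have := abs_le.1 (abs_sub_mean_le (hp i) (hp1 i) hB a)
                exact sq_le_sq' this.1 this.2
            _ = _ := by rw [← Finset.sum_mul, hp1, one_mul]
      _ = _ := by simp
  rw [le_div_iff₀ (by positivity), mul_comm, ← prodExp_const_mul]
  refine le_trans (le_trans (prodExp_mono hp fun y => ?_) h1.le) h2
  rw [Finset.sum_sub_distrib]
  split_ifs with hy
  · rw [mul_zero]
    positivity
  · rw [mul_one]
    have := not_le.1 hy
    gcongr
    linarith

end LogLikelihoodSums

section Converse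

variable {W : X → Y → ℝ} {w : Y → ℝ} {N M : ℕ} {ε : ℝ}

lemma one_sub_error_mul_card_le (hW : IsDMC W) (hw : ∀ x y, W x y ≤ w y) (hM : 0 < M)
    (f : Fin M → Fin N → X) (φ : (Fin N → Y) → Fin M) (he : avgErrorProb W f φ ≤ ε)
    (A : (Fin N → Y) → Prop) [DecidablePred A] :
    (1 - ε) * M ≤ ∑ m, prodExp (fun n => W (f m n)) (fun y => if A y then 0 else 1) +
      ∑ y : Fin N → Y, if A y then ∏ n, w (y n) else 0 := by
  have hM' : (0 : ℝ) < M := by exact_mod_cast hM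
  have hpos : ∀ m (y : Fin N → Y), 0 ≤ ∏ n, W (f m n) (y n) := fun m y =>
    Finset.prod_nonneg fun n _ => hW.1 _ _
  have h1 : ∀ m, msgErrorProb W f φ m =
      1 - ∑ y : Fin N → Y, if φ y = m then ∏ n, W (f m n) (y n) else 0 := fun m => by
    have e : ∑ y : Fin N → Y, ∏ n, W (f m n) (y n) = 1 := by
      rw [← Fintype.prod_sum]
      simp [hW.2]
    rw [← Finset.sum_filter, ← e, eq_sub_iff_add_eq, add_comm]
    exact Finset.sum_filter_add_sum_filter_not _ _ _
  have h2 : avgErrorProb W f φ =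
      1 - (M : ℝ)⁻¹ * ∑ y : Fin N → Y, ∏ n, W (f (φ y) n) (y n) := by
    unfold avgErrorProb
    simp only [h1, Finset.sum_sub_distrib]
    rw [Finset.sum_comm]
    simp only [Finset.sum_ite_eq, Finset.mem_univ, if_true]
    simp [mul_sub, hM'.ne']
  rw [h2] at he
  have h3 : (1 - ε) * M ≤ ∑ y : Fin N → Y, ∏ n, W (f (φ y) n) (y n) := by
    have : 1 - ε ≤ (M : ℝ)⁻¹ * ∑ y : Fin N → Y, ∏ n, W (f (φ y) n) (y n) := by linarith
    rwa [inv_mul_eq_div, le_div_iff₀ hM'] at this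
  refine h3.trans ?_
  unfold prodExp
  rw [Finset.sum_comm, ← Finset.sum_add_distrib]
  refine Finset.sum_le_sum fun y _ => ?_
  beta_reduce
  split_ifs
  · simp only [mul_zero, Finset.sum_const_zero, zero_add]
    exact Finset.prod_le_prod (fun n _ => hW.1 _ _) fun n _ => hw _ _
  · simp only [mul_one, add_zero]
    exact Finset.single_le_sum (f := fun m => ∏ n, W (f m n) (y n)) (fun m _ => hpos m y)
      (Finset.mem_univ (φ y))

/-- A converse bound for codes over channels dominated by a function `w` of the output alone. -/
lemma one_sub_error_le (hW : IsDMC W) (hw : ∀ x y, W x y ≤ w y) (hw0 : ∀ y, 0 ≤ w y)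
    {q : Y → ℝ} (hq : ∀ y, 0 ≤ q y) (hwq : ∀ y, 0 < w y → 0 < q y) (hM : 0 < M)
    (f : Fin M → Fin N → X) (φ : (Fin N → Y) → Fin M) (he : avgErrorProb W f φ ≤ ε)
    {L a : ℝ} (ha : ∀ m, prodExp (fun n => W (f m n))
      (fun y => if ∑ n, Real.log (w (y n) / q (y n)) ≤ L then 0 else 1) ≤ a) :
    1 - ε ≤ a + prodExp (fun _ : Fin N => q) (fun y =>
      if ∑ n, Real.log (w (y n) / q (y n)) ≤ L then
        Real.exp (∑ n, Real.log (w (y n) / q (y n)) - Real.log M) else 0) := by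
  have hM' : (0 : ℝ) < M := by exact_mod_cast hM
  have h1 := one_sub_error_mul_card_le hW hw hM f φ he
    (fun y => ∑ n, Real.log (w (y n) / q (y n)) ≤ L)
  have h2 : ∑ m, prodExp (fun n => W (f m n))
      (fun y => if ∑ n, Real.log (w (y n) / q (y n)) ≤ L then 0 else 1) ≤ M * a := by
    calc _ ≤ ∑ _m : Fin M, a := Finset.sum_le_sum fun m _ => ha m
      _ = M * a := by simp
  have h3 : (∑ y : Fin N → Y, if ∑ n, Real.log (w (y n) / q (y n)) ≤ L then
      ∏ n, w (y n) else 0) ≤ M * prodExp (fun _ : Fin N => q) (fun y =>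
      if ∑ n, Real.log (w (y n) / q (y n)) ≤ L then
        Real.exp (∑ n, Real.log (w (y n) / q (y n)) - Real.log M) else 0) := by
    rw [← prodExp_const_mul]
    refine Finset.sum_le_sum fun y _ => ?_
    beta_reduce
    split_ifs
    · rw [Real.exp_sub, Real.exp_log hM', mul_div_cancel₀ _ hM'.ne', Real.exp_sum,
        ← Finset.prod_mul_distrib]
      refine Finset.prod_le_prod (fun n _ => hw0 _) fun n _ => ?_
      rcases (hw0 (y n)).eq_or_lt with h0 | h0
      · rw [← h0]
        exact mul_nonneg (hq _) (Real.exp_pos _).le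
      · have := hwq _ h0
        rw [Real.exp_log (by positivity), mul_div_cancel₀ _ this.ne']
    · simp
  have h4 : M * (1 - ε) ≤ M * (a + prodExp (fun _ : Fin N => q) (fun y =>
      if ∑ n, Real.log (w (y n) / q (y n)) ≤ L then
        Real.exp (∑ n, Real.log (w (y n) / q (y n)) - Real.log M) else 0)) := by
    rw [mul_add]
    linarith
  exact le_of_mul_le_mul_left h4 hM'

end Converse

section Capacity

variable {W : X → Y → ℝ} {w : Y → ℝ}

lemma exists_outputWeight (hW : IsDMC W) (hsing : Singular W) :
    ∃ w : Y → ℝ, (∀ x y, W x y = 0 ∨ W x y = w y) ∧ (∀ y, 0 ≤ w y) ∧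
      ∀ y, 0 < w y → ∃ x, 0 < W x y := by
  have h : ∀ y, ∃ v : ℝ, (∀ x, W x y = 0 ∨ W x y = v) ∧ 0 ≤ v ∧ (0 < v → ∃ x, 0 < W x y) := by
    intro y
    by_cases hy : ∃ x, 0 < W x y
    · obtain ⟨x, hx⟩ := hy
      refine ⟨W x y, fun z => ?_, hx.le, fun _ => ⟨x, hx⟩⟩
      rcases (hW.1 z y).eq_or_lt with h0 | h0
      · exact Or.inl h0.symm
      · exact Or.inr (hsing z x y (mul_pos h0 hx))
    · push Not at hy
      exact ⟨0, fun z => Or.inl (le_antisymm (hy z) (hW.1 z y)), le_rfl, fun h => absurd h (lt_irrefl 0)⟩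
  choose w h1 h2 h3 using h
  exact ⟨w, fun x y => h1 y x, h2, h3⟩

lemma sum_mul_sub_sq_eq {p : Y → ℝ} (hp1 : ∑ y, p y = 1) (g : Y → ℝ) (c : ℝ) :
    ∑ y, p y * (g y - c) ^ 2 =
      ∑ y, p y * (g y - ∑ b, p b * g b) ^ 2 + (∑ b, p b * g b - c) ^ 2 := by
  set m := ∑ b, p b * g b with hm
  have h : ∀ y, p y * (g y - c) ^ 2 = p y * (g y - m) ^ 2 +
      2 * (m - c) * (p y * g y) - (m - c) * (m + c) * p y := fun y => by ring
  simp only [h, Finset.sum_add_distrib, Finset.sum_sub_distrib, ← Finset.mul_sum, hp1, ← hm]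
  ring

lemma sum_mul_sub_mean_sq_le {p : Y → ℝ} (hp1 : ∑ y, p y = 1) (g : Y → ℝ) (c : ℝ) :
    ∑ y, p y * (g y - ∑ b, p b * g b) ^ 2 ≤ ∑ y, p y * (g y - c) ^ 2 := by
  rw [sum_mul_sub_sq_eq hp1 g c]
  linarith [sq_nonneg (∑ b, p b * g b - c)]

lemma IsProbDist.output (hW : IsDMC W) {Q : X → ℝ} (hQ : IsProbDist Q) :
    IsProbDist fun y => ∑ x, Q x * W x y := by
  refine ⟨fun y => Finset.sum_nonneg fun x _ => mul_nonneg (hQ.1 x) (hW.1 x y), ?_⟩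
  rw [Finset.sum_comm]
  simp [← Finset.mul_sum, hW.2, hQ.2]

lemma sum_mul_sum_mul (W : X → Y → ℝ) (Q : X → ℝ) (g : Y → ℝ) :
    ∑ x, Q x * ∑ y, W x y * g y = ∑ y, (∑ x, Q x * W x y) * g y := by
  simp only [Finset.mul_sum, Finset.sum_mul]
  rw [Finset.sum_comm]
  simp only [mul_assoc]

lemma mutualInfo_eq (hW : IsDMC W) (hw : ∀ x y, W x y = 0 ∨ W x y = w y) {Q : X → ℝ}
    (hQ : IsProbDist Q) :
    mutualInfo W Q = ∑ y, ((∑ x, Q x * W x y) * Real.log (w y) +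
      Real.negMulLog (∑ x, Q x * W x y)) := by
  unfold mutualInfo
  rw [Finset.sum_comm]
  refine Finset.sum_congr rfl fun y _ => ?_
  have h : ∀ x, Q x * W x y * Real.log (W x y / ∑ z, Q z * W z y) =
      Q x * W x y * (Real.log (w y) - Real.log (∑ z, Q z * W z y)) := fun x => by
    rcases (mul_nonneg (hQ.1 x) (hW.1 x y)).eq_or_lt with h0 | h0
    · rw [← h0]
      simp
    · have h1 : 0 < ∑ z, Q z * W z y := lt_of_lt_of_le h0
        (Finset.single_le_sum (f := fun z => Q z * W z y)
          (fun z _ => mul_nonneg (hQ.1 z) (hW.1 z y)) (Finset.mem_univ x))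
      have h2 : W x y ≠ 0 := fun h => by simp [h] at h0
      rw [Real.log_div h2 h1.ne', (hw x y).resolve_left h2]
  simp only [h, ← Finset.sum_mul, Real.negMulLog]
  ring

lemma exists_mutualInfo_eq_capacity [Nonempty X] (hW : IsDMC W)
    (hw : ∀ x y, W x y = 0 ∨ W x y = w y) :
    ∃ Q, IsProbDist Q ∧ mutualInfo W Q = capacity W ∧
      ∀ Q', IsProbDist Q' → mutualInfo W Q' ≤ capacity W := by
  classical
  have hc : ContinuousOn (mutualInfo W) (stdSimplex ℝ X) := by
    have : Continuous fun Q : X → ℝ => ∑ y, ((∑ x, Q x * W x y) * Real.log (w y) +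
      Real.negMulLog (∑ x, Q x * W x y)) := by
      have := Real.continuous_negMulLog
      fun_prop
    exact this.continuousOn.congr fun Q hQ => mutualInfo_eq hW hw hQ
  obtain ⟨x⟩ := ‹Nonempty X›
  obtain ⟨Q, hQ, hmax⟩ := (isCompact_stdSimplex ℝ X).exists_isMaxOn
    ⟨_, single_mem_stdSimplex ℝ x⟩ hc
  have hg : IsGreatest {r | ∃ Q, IsProbDist Q ∧ r = mutualInfo W Q} (mutualInfo W Q) := by
    refine ⟨⟨Q, hQ, rfl⟩, ?_⟩
    rintro _ ⟨Q', hQ', rfl⟩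
    exact hmax hQ'
  have e : capacity W = mutualInfo W Q := hg.csSup_eq
  exact ⟨Q, hQ, e.symm, fun Q' hQ' => e ▸ hmax hQ'⟩

lemma exists_mix_isProbDist {Q : X → ℝ} (hQ : IsProbDist Q) (W : X → Y → ℝ) (x : X) {t : ℝ}
    (ht0 : 0 < t) (ht1 : t < 1) :
    ∃ Q', IsProbDist Q' ∧
      ∀ y, ∑ z, Q' z * W z y = (1 - t) * (∑ z, Q z * W z y) + t * W x y := by
  classical
  refine ⟨fun z => (1 - t) * Q z + t * if z = x then 1 else 0, ⟨fun z => ?_, ?_⟩, fun y => ?_⟩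
  · have := hQ.1 z
    have : 0 ≤ 1 - t := by linarith
    positivity
  · simp [Finset.sum_add_distrib, ← Finset.mul_sum, hQ.2]
  · simp [add_mul, Finset.sum_add_distrib, Finset.mul_sum, mul_assoc]

lemma output_pos_of_capacity (hW : IsDMC W) (hw : ∀ x y, W x y = 0 ∨ W x y = w y) {Q : X → ℝ}
    (hQ : IsProbDist Q) (hC : mutualInfo W Q = capacity W)
    (hmax : ∀ Q', IsProbDist Q' → mutualInfo W Q' ≤ capacity W) {x : X} {y : Y}
    (hxy : 0 < W x y) : 0 < ∑ z, Q z * W z y := by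
  classical
  refine lt_of_le_of_ne ((hQ.output hW).1 y) fun h0 => ?_
  have key : ∀ t : ℝ, 0 < t → t < 1 → -(W x y * Real.log t) ≤ capacity W := by
    intro t ht0 ht1
    obtain ⟨Q', hQ', e⟩ := exists_mix_isProbDist hQ W x ht0 ht1
    have h1 := hmax Q' hQ'
    rw [mutualInfo_eq hW hw hQ'] at h1
    simp only [e] at h1
    have h2 : ∀ b, (1 - t) * ((∑ z, Q z * W z b) * Real.log (w b) +
        Real.negMulLog (∑ z, Q z * W z b)) +
        (if b = y then W x y * Real.negMulLog t else 0) ≤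
        ((1 - t) * (∑ z, Q z * W z b) + t * W x b) * Real.log (w b) +
          Real.negMulLog ((1 - t) * (∑ z, Q z * W z b) + t * W x b) := by
      intro b
      have hD : W x b * Real.log (w b) + Real.negMulLog (W x b) = 0 := by
        rcases hw x b with h | h
        · simp [h]
        · simp [h, Real.negMulLog]
      split_ifs with hb
      · subst hb
        rw [← h0, mul_zero, zero_add, Real.negMulLog_mul]
        simp only [zero_mul, Real.negMulLog_zero]
        nlinarith
      · have hcc := Real.concaveOn_negMulLog.2 (Set.mem_Ici.2 ((hQ.output hW).1 b))
          (Set.mem_Ici.2 (hW.1 x b)) (by linarith : 0 ≤ 1 - t) ht0.le (by ring)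
        simp only [smul_eq_mul] at hcc
        nlinarith
    have h3 := (Finset.sum_le_sum fun b (_ : b ∈ Finset.univ) => h2 b).trans h1
    rw [Finset.sum_add_distrib, ← Finset.mul_sum, ← mutualInfo_eq hW hw hQ, hC,
      Finset.sum_ite_eq' Finset.univ y, if_pos (Finset.mem_univ y), Real.negMulLog] at h3
    have h4 : t * (-(W x y * Real.log t)) ≤ t * capacity W := by nlinarith
    exact le_of_mul_le_mul_left h4 ht0
  have h5 := key (Real.exp (-((|capacity W| + 1) / W x y))) (Real.exp_pos _) (by
    rw [Real.exp_lt_one_iff, neg_lt_zero]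
    positivity)
  rw [Real.log_exp, mul_neg, neg_neg, mul_div_cancel₀ _ hxy.ne'] at h5
  linarith [le_abs_self (capacity W)]

lemma mul_log_add_negMulLog_ge {u r v : ℝ} (hu : 0 ≤ u) (hr : 0 < r) (hv : 0 < v) :
    u * Real.log (v / r) - (u - r) - (u - r) ^ 2 / r ≤ u * Real.log v + Real.negMulLog u := by
  rcases hu.eq_or_lt with h0 | h0
  · rw [← h0]
    have : r ^ 2 / r = r := by field_simp
    simp [this]
  · have h1 := Real.log_le_sub_one_of_pos (div_pos h0 hr)
    rw [Real.log_div h0.ne' hr.ne'] at h1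
    rw [Real.log_div hv.ne' hr.ne', Real.negMulLog]
    have e : (u - r) + (u - r) ^ 2 / r = u * (u / r - 1) := by field_simp; ring
    nlinarith

lemma sum_mul_log_le_capacity (hW : IsDMC W) (hw : ∀ x y, W x y = 0 ∨ W x y = w y)
    (hwx : ∀ y, 0 < w y → ∃ x, 0 < W x y) {Q : X → ℝ}
    (hQ : IsProbDist Q) (hC : mutualInfo W Q = capacity W)
    (hmax : ∀ Q', IsProbDist Q' → mutualInfo W Q' ≤ capacity W) (x : X) :
    ∑ y, W x y * Real.log (w y / ∑ z, Q z * W z y) ≤ capacity W := by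
  set r : Y → ℝ := fun y => ∑ z, Q z * W z y with hr
  have hrp : IsProbDist r := hQ.output hW
  have hr1 : ∑ y, r y * Real.log (w y / r y) = capacity W := by
    rw [← hC, mutualInfo_eq hW hw hQ]
    refine Finset.sum_congr rfl fun y _ => ?_
    rcases (hrp.1 y).eq_or_lt with h0 | h0
    · have : ∑ z, Q z * W z y = 0 := h0.symm
      rw [← h0, this]
      simp
    · have : w y ≠ 0 := fun h => by
        have : ∀ z, W z y = 0 := fun z => (hw z y).elim id fun e => e.trans h
        simp [hr, this] at h0
      rw [Real.log_div this h0.ne', Real.negMulLog]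
      ring
  set χ := ∑ y, (W x y - r y) ^ 2 / r y
  have hχ : 0 ≤ χ := Finset.sum_nonneg fun y _ => div_nonneg (sq_nonneg _) (hrp.1 y)
  have key : ∀ t : ℝ, 0 < t → t < 1 →
      ∑ y, W x y * Real.log (w y / r y) - capacity W ≤ t * χ := by
    intro t ht0 ht1
    obtain ⟨Q', hQ', e⟩ := exists_mix_isProbDist hQ W x ht0 ht1
    have h1 := hmax Q' hQ'
    rw [mutualInfo_eq hW hw hQ'] at h1
    have h2 : ∀ y, (1 - t) * (r y * Real.log (w y / r y)) + t * (W x y * Real.log (w y / r y)) -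
        t * (W x y - r y) - t ^ 2 * ((W x y - r y) ^ 2 / r y) ≤
        (∑ z, Q' z * W z y) * Real.log (w y) + Real.negMulLog (∑ z, Q' z * W z y) := by
      intro y
      by_cases h0 : 0 < w y
      · obtain ⟨x', hx'⟩ := hwx y h0
        have hry : 0 < r y := output_pos_of_capacity hW hw hQ hC hmax hx'
        refine le_trans (le_of_eq ?_) (mul_log_add_negMulLog_ge ((hQ'.output hW).1 y) hry h0)
        rw [e y]
        change _ = ((1 - t) * r y + t * W x y) * Real.log (w y / r y) -
          ((1 - t) * r y + t * W x y - r y) - ((1 - t) * r y + t * W x y - r y) ^ 2 / r y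
        ring
      · have h3 : ∀ z, W z y = 0 := fun z => (hw z y).elim id fun e =>
          le_antisymm (e.trans_le (not_lt.1 h0)) (hW.1 z y)
        simp [hr, h3]
    have h3 := (Finset.sum_le_sum fun y (_ : y ∈ Finset.univ) => h2 y).trans h1
    simp only [Finset.sum_sub_distrib, Finset.sum_add_distrib, ← Finset.mul_sum] at h3
    rw [hr1, hW.2, hrp.2] at h3
    change (1 - t) * capacity W + t * _ - t * (1 - 1) - t ^ 2 * χ ≤ _ at h3
    have h4 : t * (∑ y, W x y * Real.log (w y / r y) - capacity W) ≤ t * (t * χ) := by nlinarith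
    exact le_of_mul_le_mul_left h4 ht0
  by_contra! hlt
  set d := ∑ y, W x y * Real.log (w y / r y) - capacity W with hd
  have hd0 : 0 < d := sub_pos.2 hlt
  have h5 := key (d / (2 * (d + χ))) (by positivity) (by
    rw [div_lt_one (by positivity)]
    linarith)
  rw [div_mul_eq_mul_div, le_div_iff₀ (by positivity)] at h5
  nlinarith

lemma Veps_le (hW : IsDMC W) (hw : ∀ x y, W x y = 0 ∨ W x y = w y) {Q : X → ℝ}
    (hQ : IsProbDist Q) (hC : mutualInfo W Q = capacity W) {ε : ℝ} (hε : ε < 1 / 2) (c : ℝ) :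
    Veps W ε ≤ ∑ y, (∑ x, Q x * W x y) *
      (Real.log (w y / ∑ z, Q z * W z y) - c) ^ 2 := by
  have hb : BddBelow {v | ∃ Q, IsProbDist Q ∧ mutualInfo W Q = capacity W ∧ v = Vdisp W Q} := by
    refine ⟨0, ?_⟩
    rintro _ ⟨Q', hQ', -, rfl⟩
    exact Finset.sum_nonneg fun x _ => Finset.sum_nonneg fun y _ =>
      mul_nonneg (mul_nonneg (hQ'.1 x) (hW.1 x y)) (sq_nonneg _)
  rw [Veps, if_pos hε]
  refine (csInf_le hb ⟨Q, hQ, hC, rfl⟩).trans ?_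
  rw [← sum_mul_sum_mul]
  unfold Vdisp
  refine Finset.sum_le_sum fun x _ => ?_
  simp only [mul_assoc, ← Finset.mul_sum]
  refine mul_le_mul_of_nonneg_left ?_ (hQ.1 x)
  set g : Y → ℝ := fun y => Real.log (W x y / ∑ z, Q z * W z y)
  have e : ∀ y, W x y * (Real.log (w y / ∑ z, Q z * W z y) - c) ^ 2 = W x y * (g y - c) ^ 2 :=
    fun y => by
      rcases hw x y with h | h
      · simp [h]
      · simp only [g, h]
  simp only [e]
  exact sum_mul_sub_mean_sq_le (hW.2 x) g c

end Capacity

section GaussianInverse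

lemma neg_mul_stdGaussCDF_le_one {x : ℝ} (hx : x ≤ 0) : -x * stdGaussCDF x ≤ 1 := by
  refine le_trans (mul_le_mul_of_nonneg_left ?_ (neg_nonneg.2 hx)) (neg_mul_millsRatio_le (w := x))
  refine le_mul_of_one_le_right (stdGaussCDF_nonneg x) ?_
  refine one_le_mul_of_one_le_of_one_le (Real.one_le_sqrt.2 ?_) (Real.one_le_exp (by positivity))
  linarith [Real.pi_gt_three]

lemma stdGaussInvCDF_nonpos_and_le {ε : ℝ} (hε0 : 0 < ε) (hε1 : ε < 1 / 2) :
    stdGaussInvCDF ε ≤ 0 ∧ ε ≤ stdGaussCDF (stdGaussInvCDF ε) := by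
  have h0 : (0 : ℝ) ∈ {x | ε ≤ stdGaussCDF x} := by
    change ε ≤ stdGaussCDF 0
    rw [stdGaussCDF_zero]
    exact hε1.le
  have hb : BddBelow {x | ε ≤ stdGaussCDF x} := by
    refine ⟨-(1 / ε), fun x hx => ?_⟩
    rcases le_total 0 x with h | h
    · exact le_trans (neg_nonpos.2 (by positivity)) h
    · have h1 := neg_mul_stdGaussCDF_le_one h
      change ε ≤ stdGaussCDF x at hx
      have h2 : -x * ε ≤ 1 := le_trans (mul_le_mul_of_nonneg_left hx (neg_nonneg.2 h)) h1
      rw [neg_le, le_div_iff₀ hε0]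
      exact h2
  have hcl : IsClosed {x | ε ≤ stdGaussCDF x} :=
    isClosed_le continuous_const continuous_stdGaussCDF
  exact ⟨csInf_le hb h0, hcl.csInf_mem ⟨0, h0⟩ hb⟩

lemma exists_stdGaussCDF_add_ge (z : ℝ) :
    ∃ κ, 0 < κ ∧ ∀ h, 0 ≤ h → h ≤ 1 → stdGaussCDF z + κ * h ≤ stdGaussCDF (z + h) := by
  refine ⟨(Real.sqrt (2 * Real.pi))⁻¹ * Real.exp (-(|z| + 1) ^ 2 / 2),
    mul_pos (inv_pos.2 sqrt_two_pi_pos) (Real.exp_pos _), fun h h0 h1 => ?_⟩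
  have := (convex_Icc z (z + 1)).mul_sub_le_image_sub_of_le_deriv
    continuous_stdGaussCDF.continuousOn
    (fun x _ => (hasDerivAt_stdGaussCDF x).differentiableAt.differentiableWithinAt)
    (C := (Real.sqrt (2 * Real.pi))⁻¹ * Real.exp (-(|z| + 1) ^ 2 / 2)) (fun x hx => by
      rw [(hasDerivAt_stdGaussCDF x).deriv]
      rw [interior_Icc] at hx
      have h2 : |x| ≤ |z| + 1 := abs_le.2 ⟨by linarith [hx.1, neg_abs_le z],
        by linarith [hx.2, le_abs_self z]⟩
      have h3 := pow_le_pow_left₀ (abs_nonneg x) h2 2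
      rw [sq_abs] at h3
      gcongr) z ⟨le_rfl, by linarith⟩ (z + h) ⟨by linarith, by linarith⟩ (by linarith)
  rw [add_sub_cancel_left] at this
  linarith

end GaussianInverse

section OutputMixture

lemma abs_log_one_add_le {u : ℝ} (hu : -(1 / 2) ≤ u) : |Real.log (1 + u)| ≤ 2 * |u| := by
  have hp : 0 < 1 + u := by linarith
  have h1 := Real.log_le_sub_one_of_pos hp
  have h2 := Real.one_sub_inv_le_log_of_pos hp
  have h3 : 1 - (1 + u)⁻¹ = u / (1 + u) := by field_simp; ring
  have h4 : -(2 * |u|) ≤ u / (1 + u) := by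
    rw [le_div_iff₀ hp]
    nlinarith [neg_abs_le u, abs_nonneg u]
  exact abs_le.2 ⟨by linarith, by linarith [le_abs_self u, abs_nonneg u]⟩

lemma sub_add_sq_le_mul_log {q r : ℝ} (hq : 0 < q) (hq1 : q ≤ 1) (hr : 0 < r) (hr1 : r ≤ 1) :
    (q - r) + (q - r) ^ 2 ≤ (2 * q - r) * Real.log (q / r) := by
  have hqr := div_pos hq hr
  have h1 := Real.log_le_sub_one_of_pos hqr
  have h2 := Real.one_sub_inv_le_log_of_pos hqr
  rw [inv_div] at h2
  have h3 : q - r ≤ q * Real.log (q / r) := by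
    calc q - r = q * (1 - r / q) := by field_simp
      _ ≤ _ := by gcongr
  have h4 : (q - r) ^ 2 ≤ (q - r) * Real.log (q / r) := by
    rcases le_total r q with h | h
    · calc (q - r) ^ 2 ≤ (q - r) ^ 2 / q := (le_div_self (sq_nonneg _) hq hq1)
        _ = (q - r) * (1 - r / q) := by field_simp
        _ ≤ _ := mul_le_mul_of_nonneg_left h2 (sub_nonneg.2 h)
    · calc (q - r) ^ 2 ≤ (q - r) ^ 2 / r := (le_div_self (sq_nonneg _) hr hr1)
        _ = (q - r) * (q / r - 1) := by field_simp
        _ ≤ _ := mul_le_mul_of_nonpos_left h1 (sub_nonpos.2 h)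
  linarith

lemma IsProbDist.le_one {q : Y → ℝ} (hq : IsProbDist q) (y : Y) : q y ≤ 1 :=
  hq.2 ▸ Finset.single_le_sum (fun y _ => hq.1 y) (Finset.mem_univ y)

lemma exists_abs_log_div_le {w r : Y → ℝ} (hw : ∀ y, 0 ≤ w y)
    (hwr : ∀ y, 0 < w y → 0 < r y) :
    ∃ B, 1 ≤ B ∧ ∀ q : Y → ℝ, (∀ y, r y / 2 ≤ q y) → (∀ y, q y ≤ 1) →
      ∀ y, |Real.log (w y / q y)| ≤ B := by
  have h0 : ∀ y, 0 ≤ |Real.log (w y)| + |Real.log (r y / 2)| := fun y => by positivity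
  refine ⟨∑ y, (|Real.log (w y)| + |Real.log (r y / 2)|) + 1,
    by linarith [Finset.sum_nonneg fun y (_ : y ∈ Finset.univ) => h0 y], fun q hq hq1 y => ?_⟩
  have h1 := Finset.single_le_sum (fun y _ => h0 y) (Finset.mem_univ y)
  rcases (hw y).eq_or_lt with h | h
  · rw [← h]
    simp only [zero_div, Real.log_zero, abs_zero]
    linarith [h0 y]
  · have hry := hwr y h
    have hqy : 0 < q y := lt_of_lt_of_le (by positivity) (hq y)
    rw [Real.log_div h.ne' hqy.ne']
    have h2 : |Real.log (q y)| ≤ |Real.log (r y / 2)| := by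
      have h3 := Real.log_le_log (by positivity) (hq y)
      have h4 := Real.log_nonpos hqy.le (hq1 y)
      rw [abs_of_nonpos h4, abs_of_nonpos (h3.trans h4)]
      linarith
    linarith [abs_sub (Real.log (w y)) (Real.log (q y))]

end OutputMixture

section Mixture

variable {W : X → Y → ℝ} {w r : Y → ℝ} {C : ℝ}

/-- The output distribution induced by `P`, averaged with `r`. -/
noncomputable def mixedOutput (W : X → Y → ℝ) (r : Y → ℝ) (P : X → ℝ) (y : Y) : ℝ :=
  ((∑ x, P x * W x y) + r y) / 2

/-- The log-likelihood ratio against `mixedOutput`. -/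
noncomputable def mixedLog (W : X → Y → ℝ) (w r : Y → ℝ) (P : X → ℝ) (y : Y) : ℝ :=
  Real.log (w y / mixedOutput W r P y)

lemma mixedOutput_isProbDist (hW : IsDMC W) (hr : IsProbDist r) {P : X → ℝ} (hP : IsProbDist P) :
    IsProbDist (mixedOutput W r P) := by
  have h := hP.output hW
  refine ⟨fun y => div_nonneg (add_nonneg (h.1 y) (hr.1 y)) zero_le_two, ?_⟩
  unfold mixedOutput
  rw [← Finset.sum_div, Finset.sum_add_distrib, h.2, hr.2]
  norm_num

lemma half_le_mixedOutput (hW : IsDMC W) {P : X → ℝ} (hP : IsProbDist P) (y : Y) :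
    r y / 2 ≤ mixedOutput W r P y := by
  have h := (hP.output hW).1 y
  unfold mixedOutput
  linarith

lemma half_output_le_mixedOutput (hr : IsProbDist r) (P : X → ℝ) (y : Y) :
    (∑ x, P x * W x y) / 2 ≤ mixedOutput W r P y := by
  have h := hr.1 y
  unfold mixedOutput
  linarith

lemma output_eq_zero (hw : ∀ x y, W x y = 0 ∨ W x y = w y) (P : X → ℝ) {y : Y} (hy : w y = 0) :
    ∑ x, P x * W x y = 0 :=
  Finset.sum_eq_zero fun x _ => by
    rcases hw x y with h | h <;> simp [h, hy]

lemma mean_mixedLog_le (hW : IsDMC W) (hw : ∀ x y, W x y = 0 ∨ W x y = w y)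
    (hw0 : ∀ y, 0 ≤ w y) (hr : IsProbDist r) (hwr : ∀ y, 0 < w y → 0 < r y)
    (hrw : ∀ y, w y = 0 → r y = 0) {P : X → ℝ} (hP : IsProbDist P) :
    ∑ x, P x * ∑ y, W x y * mixedLog W w r P y ≤
      ∑ x, P x * (∑ y, W x y * Real.log (w y / r y)) -
        (∑ y, ((∑ x, P x * W x y) - r y) ^ 2) / 4 := by
  have hqP := hP.output hW
  have hq := mixedOutput_isProbDist hW hr hP
  rw [sum_mul_sum_mul, sum_mul_sum_mul]
  have h : ∀ y, (∑ x, P x * W x y) * mixedLog W w r P y ≤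
      (∑ x, P x * W x y) * Real.log (w y / r y) - (mixedOutput W r P y - r y) -
        ((∑ x, P x * W x y) - r y) ^ 2 / 4 := fun y => by
    rcases (hw0 y).eq_or_lt with h0 | h0
    · simp [mixedOutput, output_eq_zero hw P h0.symm, hrw y h0.symm]
    · have hry := hwr y h0
      have hqy : 0 < mixedOutput W r P y :=
        lt_of_lt_of_le (by positivity) (half_le_mixedOutput hW hP y)
      have h1 := sub_add_sq_le_mul_log hqy (hq.le_one y) hry (hr.le_one y)
      unfold mixedLog
      rw [Real.log_div hqy.ne' hry.ne'] at h1
      rw [Real.log_div h0.ne' hqy.ne', Real.log_div h0.ne' hry.ne']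
      have e : ∑ x, P x * W x y = 2 * mixedOutput W r P y - r y := by
        unfold mixedOutput
        ring
      rw [e]
      nlinarith
  refine (Finset.sum_le_sum fun y _ => h y).trans (le_of_eq ?_)
  rw [Finset.sum_sub_distrib, Finset.sum_sub_distrib, Finset.sum_sub_distrib, hq.2, hr.2,
    Finset.sum_div]
  ring

lemma half_condVar_le (hW : IsDMC W) (hr : IsProbDist r) {P : X → ℝ} (hP : IsProbDist P)
    (g : Y → ℝ) :
    (∑ x, P x * ∑ y, W x y * (g y - ∑ b, W x b * g b) ^ 2) / 2 ≤
      ∑ y, mixedOutput W r P y * (g y - ∑ b, mixedOutput W r P b * g b) ^ 2 := by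
  set m := ∑ b, mixedOutput W r P b * g b
  calc _ ≤ (∑ x, P x * ∑ y, W x y * (g y - m) ^ 2) / 2 := by
        refine div_le_div_of_nonneg_right (Finset.sum_le_sum fun x _ => ?_) zero_le_two
        exact mul_le_mul_of_nonneg_left (sum_mul_sub_mean_sq_le (hW.2 x) g m) (hP.1 x)
    _ = ∑ y, (∑ x, P x * W x y) / 2 * (g y - m) ^ 2 := by
        rw [sum_mul_sum_mul, Finset.sum_div]
        refine Finset.sum_congr rfl fun y _ => by ring
    _ ≤ _ := Finset.sum_le_sum fun y _ =>
        mul_le_mul_of_nonneg_right (half_output_le_mixedOutput hr P y) (sq_nonneg _)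

lemma condVar_mixedLog_ge (hW : IsDMC W) (hw0 : ∀ y, 0 ≤ w y) (hr : IsProbDist r) (hwr : ∀ y, 0 < w y → 0 < r y)
    (hC : ∀ x, ∑ y, W x y * Real.log (w y / r y) ≤ C)
    {B : ℝ} (hB : ∀ q : Y → ℝ, (∀ y, r y / 2 ≤ q y) → (∀ y, q y ≤ 1) →
      ∀ y, |Real.log (w y / q y)| ≤ B)
    {P : X → ℝ} (hP : IsProbDist P) {s : ℝ} (hs : ∀ y, |(∑ x, P x * W x y) - r y| ≤ s) :
    ∑ y, r y * (Real.log (w y / r y) - C) ^ 2 -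
      ((B + |C|) * (C - ∑ x, P x * ∑ y, W x y * Real.log (w y / r y)) +
      ((Fintype.card Y) * (B + |C|) ^ 2 + 3 * (B + |C|) * ∑ y, (r y)⁻¹) * s) ≤
    ∑ x, P x * ∑ y, W x y * (mixedLog W w r P y - ∑ b, W x b * mixedLog W w r P b) ^ 2 := by
  have hqP := hP.output hW
  have hq := mixedOutput_isProbDist hW hr hP
  set A := B + |C| with hA
  set R := ∑ y, (r y)⁻¹ with hR
  set i : Y → ℝ := fun y => Real.log (w y / r y) with hi
  set j : Y → ℝ := mixedLog W w r P with hj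
  have hiB : ∀ y, |i y| ≤ B := hB r (fun y => by linarith [hr.1 y]) hr.le_one
  have hjB : ∀ y, |j y| ≤ B := hB _ (half_le_mixedOutput hW hP) hq.le_one
  have hsub : ∀ {v : ℝ}, |v| ≤ B → |v - C| ≤ A := fun hv => (abs_sub _ _).trans (by linarith)
  have hji : ∀ y, |j y - i y| ≤ R * s := fun y => by
    have hs0 : 0 ≤ s := (abs_nonneg _).trans (hs y)
    rcases (hw0 y).eq_or_lt with h0 | h0
    · simp only [hj, hi, mixedLog, ← h0, zero_div, sub_self, abs_zero]
      exact mul_nonneg (Finset.sum_nonneg fun y _ => inv_nonneg.2 (hr.1 y)) hs0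
    · have hry := hwr y h0
      have hqy : 0 < mixedOutput W r P y :=
        lt_of_lt_of_le (by positivity) (half_le_mixedOutput hW hP y)
      have e : j y - i y = -Real.log (1 + ((∑ x, P x * W x y) - r y) / (2 * r y)) := by
        have e1 : 1 + ((∑ x, P x * W x y) - r y) / (2 * r y) = mixedOutput W r P y / r y := by
          unfold mixedOutput
          field_simp
          ring
        rw [e1, Real.log_div hqy.ne' hry.ne']
        simp only [hj, hi, mixedLog]
        rw [Real.log_div h0.ne' hqy.ne', Real.log_div h0.ne' hry.ne']
        ring
      rw [e, abs_neg]
      refine (abs_log_one_add_le ?_).trans ?_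
      · rw [le_div_iff₀ (by positivity)]
        linarith [hqP.1 y]
      · rw [abs_div, abs_of_pos (by positivity : 0 < 2 * r y)]
        have h1 : (r y)⁻¹ ≤ R := Finset.single_le_sum (f := fun y => (r y)⁻¹)
          (fun y _ => inv_nonneg.2 (hr.1 y)) (Finset.mem_univ y)
        calc _ = (r y)⁻¹ * |(∑ x, P x * W x y) - r y| := by field_simp
          _ ≤ R * s := mul_le_mul h1 (hs y) (abs_nonneg _) ((inv_pos.2 hry).le.trans h1)
  have hx : ∀ x, ∑ y, W x y * (j y - C) ^ 2 - A * (C - ∑ y, W x y * i y + R * s) ≤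
      ∑ y, W x y * (j y - ∑ b, W x b * j b) ^ 2 := fun x => by
    rw [sum_mul_sub_sq_eq (hW.2 x) j C]
    have h1 := hsub (sum_weight_mul_le (hW.1 x) (hW.2 x) hjB)
    have h2 := sum_weight_mul_le (hW.1 x) (hW.2 x) hji
    simp only [mul_sub, Finset.sum_sub_distrib] at h2
    have h3 : |∑ b, W x b * j b - C| ≤ C - ∑ y, W x y * i y + R * s := by
      rw [abs_le] at h2 ⊢
      constructor <;> linarith [hC x, h2.1, h2.2]
    have h4 := mul_le_mul h1 h3 (abs_nonneg _) ((abs_nonneg _).trans h1)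
    rw [← sq, sq_abs] at h4
    linarith
  have hy : ∀ y, r y * (i y - C) ^ 2 - (A ^ 2 * s + 2 * A * (R * s) * r y) ≤
      (∑ x, P x * W x y) * (j y - C) ^ 2 := fun y => by
    have h1 := hsub (hiB y)
    have h2 := hsub (hjB y)
    have hA0 : 0 ≤ A := (abs_nonneg _).trans h1
    have h3 : (i y - C) ^ 2 - (j y - C) ^ 2 ≤ 2 * A * (R * s) := by
      have e : (i y - C) ^ 2 - (j y - C) ^ 2 = ((i y - C) + (j y - C)) * -(j y - i y) := by ring
      rw [e]
      refine (le_abs_self _).trans ?_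
      rw [abs_mul, abs_neg]
      exact mul_le_mul ((abs_add_le _ _).trans (by linarith)) (hji y) (abs_nonneg _) (by positivity)
    have h4 : (j y - C) ^ 2 ≤ A ^ 2 := sq_le_sq' (by linarith [(abs_le.1 h2).1]) (abs_le.1 h2).2
    have h5 : (r y - ∑ x, P x * W x y) * (j y - C) ^ 2 ≤ s * A ^ 2 := by
      have h6 : r y - ∑ x, P x * W x y ≤ s := by linarith [(abs_le.1 (hs y)).1]
      have hs0 : 0 ≤ s := (abs_nonneg _).trans (hs y)
      exact mul_le_mul h6 h4 (sq_nonneg _) hs0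
    have h7 := mul_le_mul_of_nonneg_left h3 (hr.1 y)
    nlinarith
  have hX := Finset.sum_le_sum fun x (_ : x ∈ Finset.univ) =>
    mul_le_mul_of_nonneg_left (hx x) (hP.1 x)
  have hY := Finset.sum_le_sum fun y (_ : y ∈ Finset.univ) => hy y
  have e1 : ∑ x, P x * (∑ y, W x y * (j y - C) ^ 2 - A * (C - ∑ y, W x y * i y + R * s)) =
      ∑ y, (∑ x, P x * W x y) * (j y - C) ^ 2 -
        A * (C - ∑ x, P x * ∑ y, W x y * i y + R * s) := by
    rw [← sum_mul_sum_mul]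
    have e2 : ∀ x, P x * (∑ y, W x y * (j y - C) ^ 2 - A * (C - ∑ y, W x y * i y + R * s)) =
        P x * ∑ y, W x y * (j y - C) ^ 2 - (A * (C + R * s) * P x -
          A * (P x * ∑ y, W x y * i y)) := fun x => by ring
    simp only [e2, Finset.sum_sub_distrib, ← Finset.mul_sum, hP.2]
    ring
  have e3 : ∑ y, (r y * (i y - C) ^ 2 - (A ^ 2 * s + 2 * A * (R * s) * r y)) =
      ∑ y, r y * (i y - C) ^ 2 - (Fintype.card Y * (A ^ 2 * s) + 2 * A * (R * s)) := by
    simp only [Finset.sum_sub_distrib, Finset.sum_add_distrib, ← Finset.mul_sum, hr.2]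
    simp
    ring
  rw [e1] at hX
  rw [e3] at hY
  nlinarith

end Mixture

section ConstantComposition

variable {W : X → Y → ℝ} {w q : Y → ℝ} {N M : ℕ} {ε B μ : ℝ}

lemma ConstComp.exists_type [DecidableEq X] (hN : 0 < N) (hM : 0 < M) {f : Fin M → Fin N → X}
    (hf : ConstComp f) : ∃ P : X → ℝ, IsProbDist P ∧
      ∀ m (g : X → ℝ), ∑ n, g (f m n) = N * ∑ x, P x * g x := by
  have hN' : (0 : ℝ) < N := by exact_mod_cast hN
  set P : X → ℝ := fun x => ((univ.filter fun n => f ⟨0, hM⟩ n = x).card : ℝ) / N with hP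
  have key : ∀ m (g : X → ℝ), ∑ n, g (f m n) = N * ∑ x, P x * g x := fun m g => by
    rw [← Finset.sum_fiberwise univ (f m), Finset.mul_sum]
    refine Finset.sum_congr rfl fun x _ => ?_
    have e : ∑ n ∈ univ with f m n = x, g (f m n) = ∑ n ∈ univ with f m n = x, g x :=
      Finset.sum_congr rfl fun n hn => by rw [(Finset.mem_filter.1 hn).2]
    rw [e, Finset.sum_const, nsmul_eq_mul, hf m ⟨0, hM⟩ x, hP]
    field_simp
  refine ⟨P, ⟨fun x => by positivity, ?_⟩, key⟩
  have h1 := key ⟨0, hM⟩ fun _ => 1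
  simp only [mul_one, Finset.sum_const, Finset.card_univ, Fintype.card_fin, nsmul_eq_mul] at h1
  exact (mul_left_cancel₀ hN'.ne' (by rw [mul_one]; exact h1)).symm

lemma log_card_le_mean (hW : IsDMC W) (hw : ∀ x y, W x y ≤ w y) (hw0 : ∀ y, 0 ≤ w y)
    (hq : IsProbDist q) (hwq : ∀ y, 0 < w y → 0 < q y) (hB1 : 1 ≤ B)
    (hB : ∀ y, |Real.log (w y / q y)| ≤ B) (hN : 0 < N) (hM : 0 < M)
    (f : Fin M → Fin N → X) (φ : (Fin N → Y) → Fin M) (he : avgErrorProb W f φ ≤ ε)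
    (hε : ε ≤ 1 / 2)
    (hμ : ∀ m, ∑ n, ∑ y, W (f m n) y * Real.log (w y / q y) = N * μ) :
    Real.log M ≤ N * μ + 4 * B * Real.sqrt N + Real.log 4 := by
  have hN' : (0 : ℝ) < N := by exact_mod_cast hN
  have hs : 0 < Real.sqrt N := Real.sqrt_pos.2 hN'
  have ht : 0 < 4 * B * Real.sqrt N := by positivity
  set L := N * μ + 4 * B * Real.sqrt N with hL
  have h1 := one_sub_error_le hW hw hw0 hq.1 hwq hM f φ he (L := L) (a := 1 / 4) fun m => by
    have h2 := prodExp_upper_tail_le (p := fun n => W (f m n)) (fun n a => hW.1 _ a)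
      (fun n => hW.2 _) hB ht
    rw [hμ m] at h2
    refine h2.trans (le_of_eq ?_)
    rw [mul_pow (4 * B), Real.sq_sqrt hN'.le, Fintype.card_fin]
    field_simp
    norm_num
  have h3 : prodExp (fun _ : Fin N => q) (fun y =>
      if ∑ n, Real.log (w (y n) / q (y n)) ≤ L then
        Real.exp (∑ n, Real.log (w (y n) / q (y n)) - Real.log M) else 0) ≤
      Real.exp (L - Real.log M) := by
    refine (prodExp_mono (fun _ => hq.1) fun y => ?_).trans (prodExp_const (fun _ => hq.2) _).le
    split_ifs with h
    · gcongr
    · exact (Real.exp_pos _).le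
  have h4 : 1 / 4 ≤ Real.exp (L - Real.log M) := by linarith
  have h5 := Real.log_le_log (by norm_num) h4
  rw [Real.log_exp, one_div, Real.log_inv] at h5
  linarith

lemma stdGaussCDF_log_card_le (hW : IsDMC W) (hw : ∀ x y, W x y ≤ w y) (hw0 : ∀ y, 0 ≤ w y)
    (hq : IsProbDist q) (hwq : ∀ y, 0 < w y → 0 < q y) (hB1 : 1 ≤ B)
    (hB : ∀ y, |Real.log (w y / q y)| ≤ B) (hN : 0 < N) (hM : 0 < M)
    (f : Fin M → Fin N → X) (φ : (Fin N → Y) → Fin M) (he : avgErrorProb W f φ ≤ ε)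
    (hμ : ∀ m, ∑ n, ∑ y, W (f m n) y * Real.log (w y / q y) = N * μ) {v v' : ℝ} (hv : 0 < v)
    (hvv : v ≤ v')
    (hV : ∀ m, ∑ n, ∑ y, W (f m n) y * (Real.log (w y / q y) -
      ∑ b, W (f m n) b * Real.log (w b / q b)) ^ 2 = N * v')
    (hVq : v ≤ ∑ y, q y * (Real.log (w y / q y) - ∑ b, q b * Real.log (w b / q b)) ^ 2) :
    stdGaussCDF ((Real.log M - N * μ) / Real.sqrt (N * v')) ≤
      ε + 118 * B / Real.sqrt v / Real.sqrt N := by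
  have hN' : (0 : ℝ) < N := by exact_mod_cast hN
  have hcmp : ∀ {u : ℝ} (c : ℝ), 0 ≤ c → v ≤ u → c * B / Real.sqrt (N * u) ≤
      c * B / Real.sqrt v / Real.sqrt N := fun {u} c hc hu => by
    rw [div_div, ← Real.sqrt_mul hv.le, mul_comm v]
    gcongr
  set L := Real.log M with hL
  have h1 := one_sub_error_le hW hw hw0 hq.1 hwq hM f φ he (L := L)
    (a := 1 - stdGaussCDF ((L - N * μ) / Real.sqrt (N * v')) +
      100 * B / Real.sqrt (N * v')) fun m => by
    have hsv : sumVar (fun n => W (f m n)) (fun y => Real.log (w y / q y)) = N * v' := hV m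
    have hW1 : ∀ n : Fin N, ∑ a, W (f m n) a = 1 := fun n => hW.2 _
    have h2 := prodExp_le_lower_tail (p := fun n => W (f m n)) (fun n a => hW.1 _ a)
      hW1 hB (by linarith) (by rw [hsv]; have := hv.trans_le hvv; positivity) L
    rw [hμ m, hsv] at h2
    have e : prodExp (fun n => W (f m n))
        (fun y => if ∑ n, Real.log (w (y n) / q (y n)) ≤ L then (0 : ℝ) else 1) =
        1 - prodExp (fun n => W (f m n))
          (fun y => if ∑ n, Real.log (w (y n) / q (y n)) ≤ L then (1 : ℝ) else 0) := by
      rw [← prodExp_const hW1 (1 : ℝ), ← prodExp_sub, prodExp_const hW1]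
      refine congrArg _ (funext fun y => ?_)
      split_ifs <;> norm_num
    rw [e]
    linarith
  have hsq : sumVar (fun _ : Fin N => q) (fun y => Real.log (w y / q y)) =
      N * ∑ y, q y * (Real.log (w y / q y) - ∑ b, q b * Real.log (w b / q b)) ^ 2 := by
    simp [sumVar]
  have h3 := prodExp_exp_sub_le (p := fun _ : Fin N => q) (fun _ => hq.1)
    (fun _ => hq.2) hB (by linarith) (by rw [hsq]; have := hv.trans_le hVq; positivity) L
  rw [hsq] at h3
  have h4 := hcmp 100 (by norm_num) hvv
  have h5 := hcmp 18 (by norm_num) hVq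
  have e : 118 * B / Real.sqrt v / Real.sqrt N =
    100 * B / Real.sqrt v / Real.sqrt N + 18 * B / Real.sqrt v / Real.sqrt N := by ring
  rw [e]
  linarith

end ConstantComposition

section Assembly

lemma sqrt_sub_div_sqrt_le_sqrt {V v d : ℝ} (hV : 0 < V) (hd : 0 ≤ d) (h : V - d ≤ v) :
    Real.sqrt V - d / Real.sqrt V ≤ Real.sqrt v := by
  have hs := Real.sqrt_pos.2 hV
  have h1 : V - d ≤ Real.sqrt V * Real.sqrt v := by
    rw [← Real.sqrt_mul hV.le]
    rcases le_total (V - d) 0 with h0 | h0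
    · exact h0.trans (Real.sqrt_nonneg _)
    · refine Real.le_sqrt_of_sq_le ?_
      rw [sq]
      exact mul_le_mul (by linarith) h h0 hV.le
  have h2 : Real.sqrt V - d / Real.sqrt V = (V - d) / Real.sqrt V := by
    rw [sub_div, Real.div_sqrt]
  rw [h2, div_le_iff₀ hs]
  linarith

/-- The near-capacity part: the linear and quadratic penalties absorb the loss in dispersion. -/
lemma gaussian_bound_near {V v c lin s z n C a h K : ℝ} (hV : 0 < V) (hc : 0 ≤ c)
    (hlin : 0 ≤ lin) (hs : 0 ≤ s) (hz : z ≤ 0) (hvV : V - c * (lin + s) ≤ v)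
    (ha : a = -z * c / Real.sqrt V) (hn : 0 ≤ n) (han : a ≤ n)
    (hK : n * Real.sqrt v * h ≤ K) :
    n ^ 2 * (C - lin - s ^ 2 / 4) + n * Real.sqrt v * (z + h) ≤
      n ^ 2 * C + n * Real.sqrt V * z + K + a ^ 2 := by
  have h1 := sqrt_sub_div_sqrt_le_sqrt hV (by positivity) hvV
  have h2 : n * Real.sqrt v * z ≤ n * Real.sqrt V * z + n * a * (lin + s) := by
    have h3 := mul_le_mul_of_nonneg_left h1 (mul_nonneg hn (neg_nonneg.2 hz))
    have e : n * -z * (Real.sqrt V - c * (lin + s) / Real.sqrt V) =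
        -(n * Real.sqrt V * z) - n * a * (lin + s) := by
      rw [ha]
      ring
    rw [e] at h3
    linarith
  have h4 : n * a * lin ≤ n ^ 2 * lin := by
    rw [sq]
    gcongr
  nlinarith [sq_nonneg (n * s / 2 - a)]

lemma gaussian_bound_far {V c lin s z n C b η : ℝ} (hV : 0 < V)
    (hlin : 0 ≤ lin) (hc : 0 < c) (hfar : V / 2 ≤ c * (lin + s))
    (hη : η = min (V / (4 * c)) ((V / (4 * c)) ^ 2 / 4))
    (hB : 0 ≤ b) (hb : b = -z * Real.sqrt V + B) :
    n ^ 2 * (C - lin - s ^ 2 / 4) + B * n ≤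
      n ^ 2 * C + n * Real.sqrt V * z + b ^ 2 / η := by
  set d := V / (4 * c) with hd
  have hd0 : 0 < d := by positivity
  have hη0 : 0 < η := by
    rw [hη]
    exact lt_min hd0 (by positivity)
  have h1 : 2 * d ≤ lin + s := by
    have : 2 * d = V / 2 / c := by
      rw [hd]
      field_simp
      norm_num
    rw [this, div_le_iff₀ hc]
    linarith
  have h2 : η ≤ lin + s ^ 2 / 4 := by
    rcases le_total d lin with h | h
    · have := hη.trans_le (min_le_left _ _)
      nlinarith [sq_nonneg s]
    · have h3 := hη.trans_le (min_le_right _ _)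
      have h4 : d ≤ s := by linarith
      have h5 := pow_le_pow_left₀ hd0.le h4 2
      linarith
  have h3 : b * n ≤ n ^ 2 * η + b ^ 2 / η := by
    have e : n ^ 2 * η + b ^ 2 / η - b * n = (η * n - b / 2) ^ 2 / η + 3 / 4 * b ^ 2 / η := by
      field_simp
      ring
    have : 0 ≤ (η * n - b / 2) ^ 2 / η + 3 / 4 * b ^ 2 / η := by positivity
    linarith
  have h4 := mul_le_mul_of_nonneg_left h2 (sq_nonneg n)
  subst hb
  nlinarith

/-- Uniform second-order bound obtained from a Gaussian bound near capacity and a weak bound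
elsewhere. -/
lemma exists_uniform_bound {V c z κ C₃ B : ℝ} (hV : 0 < V) (hc : 1 ≤ c) (hz : z ≤ 0) (hκ : 0 < κ)
    (hC₃ : 0 ≤ C₃) (hB : 1 ≤ B) :
    ∃ K, 0 < K ∧ ∀ (n C L lin s v : ℝ), 1 ≤ n → 0 ≤ lin → 0 ≤ s → 0 ≤ v → v ≤ B ^ 2 →
      V - c * (lin + s) ≤ v → L ≤ n ^ 2 * (C - lin - s ^ 2 / 4) + 4 * B * n + Real.log 4 →
      (V / 2 ≤ v → (C₃ + 1) / (κ * n) ≤ 1 → L ≤ n ^ 2 * (C - lin - s ^ 2 / 4) +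
        n * Real.sqrt v * (z + (C₃ + 1) / (κ * n))) →
      L ≤ n ^ 2 * C + n * Real.sqrt V * z + K := by
  set a := -z * c / Real.sqrt V with ha
  set b := -z * Real.sqrt V + 4 * B with hb
  set η := min (V / (4 * c)) ((V / (4 * c)) ^ 2 / 4) with hη
  set n₀ := max a ((C₃ + 1) / κ) with hn₀
  have hz' : 0 ≤ -z := neg_nonneg.2 hz
  have ha0 : 0 ≤ a := by positivity
  have hb0 : 0 ≤ b := by positivity
  have hη0 : 0 < η := lt_min (by positivity) (by positivity)
  have hn₀0 : 0 ≤ n₀ := le_max_of_le_left ha0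
  have hl : 0 < Real.log 4 := Real.log_pos (by norm_num)
  have hK1 : 0 ≤ B * ((C₃ + 1) / κ) := by positivity
  have hK2 : 0 ≤ a ^ 2 := sq_nonneg a
  have hK3 : 0 ≤ b * n₀ := by positivity
  have hK4 : 0 ≤ b ^ 2 / η := by positivity
  refine ⟨B * ((C₃ + 1) / κ) + a ^ 2 + b * n₀ + b ^ 2 / η + Real.log 4, by positivity, ?_⟩
  intro n C L lin s v hn hlin hs hv hvB hvV hweak hnear
  have hn0 : 0 < n := by linarith
  by_cases hfar : V / 2 ≤ v
  · by_cases hnn : n₀ ≤ n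
    · have han : a ≤ n := (le_max_left _ _).trans hnn
      have hCn : (C₃ + 1) / κ ≤ n := (le_max_right _ _).trans hnn
      have h1 := hnear hfar (by rw [← div_div]; exact (div_le_one hn0).2 hCn)
      have h2 : n * Real.sqrt v * ((C₃ + 1) / (κ * n)) ≤ B * ((C₃ + 1) / κ) := by
        have e : n * Real.sqrt v * ((C₃ + 1) / (κ * n)) = Real.sqrt v * ((C₃ + 1) / κ) := by
          field_simp
        rw [e]
        gcongr
        exact Real.sqrt_le_iff.2 ⟨by linarith, hvB⟩
      have h3 := gaussian_bound_near (C := C) hV (by linarith) hlin hs hz hvV ha hn0.le han h2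
      linarith
    · have h1 : b * n ≤ b * n₀ := mul_le_mul_of_nonneg_left (not_le.1 hnn).le hb0
      have h2 : 0 ≤ n ^ 2 * (lin + s ^ 2 / 4) := by positivity
      have h3 : b * n = -(n * Real.sqrt V * z) + 4 * B * n := by
        rw [hb]
        ring
      linarith
  · have h1 := gaussian_bound_far (C := C) (n := n) (s := s) (B := 4 * B) hV hlin (by linarith : 0 < c)
      (by linarith) hη hb0 hb
    linarith

end Assembly

section SecondOrder

variable {W : X → Y → ℝ} {w r : Y → ℝ} {C ε : ℝ}

lemma exists_second_order_bound [DecidableEq X] (hW : IsDMC W)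
    (hw : ∀ x y, W x y = 0 ∨ W x y = w y) (hw0 : ∀ y, 0 ≤ w y) (hr : IsProbDist r)
    (hwr : ∀ y, 0 < w y → 0 < r y) (hrw : ∀ y, w y = 0 → r y = 0)
    (hC : ∀ x, ∑ y, W x y * Real.log (w y / r y) ≤ C) (hε0 : 0 < ε) (hε1 : ε < 1 / 2)
    (hV : 0 < ∑ y, r y * (Real.log (w y / r y) - C) ^ 2) :
    ∃ K : ℝ, 0 < K ∧ ∀ N M : ℕ, 0 < N → 0 < M →
      ∀ (f : Fin M → Fin N → X) (φ : (Fin N → Y) → Fin M),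
        ConstComp f → avgErrorProb W f φ ≤ ε →
          Real.log M ≤ N * C + Real.sqrt (N * ∑ y, r y * (Real.log (w y / r y) - C) ^ 2) *
            stdGaussInvCDF ε + K := by
  set V := ∑ y, r y * (Real.log (w y / r y) - C) ^ 2
  obtain ⟨hz, hΦz⟩ := stdGaussInvCDF_nonpos_and_le hε0 hε1
  set z := stdGaussInvCDF ε
  obtain ⟨κ, hκ, hΦκ⟩ := exists_stdGaussCDF_add_ge z
  obtain ⟨B, hB1, hB⟩ := exists_abs_log_div_le hw0 hwr
  have hWw : ∀ x y, W x y ≤ w y := fun x y => (hw x y).elim (fun h => h ▸ hw0 y) le_of_eq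
  set c := (B + |C|) + ((Fintype.card Y) * (B + |C|) ^ 2 + 3 * (B + |C|) * ∑ y, (r y)⁻¹) with hc
  have hA : 1 ≤ B + |C| := by linarith [abs_nonneg C]
  have hR : 0 ≤ ∑ y, (r y)⁻¹ := Finset.sum_nonneg fun y _ => inv_nonneg.2 (hr.1 y)
  have hc2 : 0 ≤ (Fintype.card Y) * (B + |C|) ^ 2 + 3 * (B + |C|) * ∑ y, (r y)⁻¹ := by positivity
  obtain ⟨K, hK0, hK⟩ := exists_uniform_bound (c := c) (C₃ := 118 * B / Real.sqrt (V / 4))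
    hV (by linarith) hz hκ (by positivity) hB1
  refine ⟨K, hK0, fun N M hN hM f φ hcc he => ?_⟩
  have hN' : (0 : ℝ) < N := by exact_mod_cast hN
  obtain ⟨P, hP, hPf⟩ := hcc.exists_type hN hM
  have hq := mixedOutput_isProbDist hW hr hP
  have hqB := hB _ (half_le_mixedOutput hW hP) hq.le_one
  have hwq : ∀ y, 0 < w y → 0 < mixedOutput W r P y := fun y hy =>
    lt_of_lt_of_le (half_pos (hwr y hy)) (half_le_mixedOutput hW hP y)
  set D := ∑ y, ((∑ x, P x * W x y) - r y) ^ 2 with hD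
  have hD0 : 0 ≤ D := Finset.sum_nonneg fun y _ => sq_nonneg _
  have hs : ∀ y, |(∑ x, P x * W x y) - r y| ≤ Real.sqrt D := fun y =>
    Real.abs_le_sqrt (Finset.single_le_sum (f := fun y => ((∑ x, P x * W x y) - r y) ^ 2)
      (fun y _ => sq_nonneg _) (Finset.mem_univ y))
  have hlin : ∑ x, P x * ∑ y, W x y * Real.log (w y / r y) ≤ C := by
    calc _ ≤ ∑ x, P x * C := Finset.sum_le_sum fun x _ =>
          mul_le_mul_of_nonneg_left (hC x) (hP.1 x)
      _ = C := by rw [← Finset.sum_mul, hP.2, one_mul]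
  have hmean := mean_mixedLog_le hW hw hw0 hr hwr hrw hP
  have hvar := condVar_mixedLog_ge hW hw0 hr hwr hC hB hP hs
  have hhalf := half_condVar_le hW hr hP (mixedLog W w r P)
  set μ := ∑ x, P x * ∑ y, W x y * mixedLog W w r P y
  set v := ∑ x, P x * ∑ y, W x y * (mixedLog W w r P y - ∑ b, W x b * mixedLog W w r P b) ^ 2
  set lin := C - ∑ x, P x * ∑ y, W x y * Real.log (w y / r y) with hlin'
  have hlin0 : 0 ≤ lin := sub_nonneg.2 hlin
  have hs0 := Real.sqrt_nonneg D
  have hμ : ∀ m, ∑ n, ∑ y, W (f m n) y * mixedLog W w r P y = N * μ := fun m =>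
    hPf m fun x => ∑ y, W x y * mixedLog W w r P y
  have hv : ∀ m, ∑ n, ∑ y, W (f m n) y * (mixedLog W w r P y -
      ∑ b, W (f m n) b * mixedLog W w r P b) ^ 2 = N * v := fun m =>
    hPf m fun x => ∑ y, W x y * (mixedLog W w r P y - ∑ b, W x b * mixedLog W w r P b) ^ 2
  have hv0 : 0 ≤ v := Finset.sum_nonneg fun x _ => mul_nonneg (hP.1 x) <|
    Finset.sum_nonneg fun y _ => mul_nonneg (hW.1 x y) (sq_nonneg _)
  have hvB : v ≤ B ^ 2 := by
    calc v ≤ ∑ x, P x * B ^ 2 := Finset.sum_le_sum fun x _ => by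
          refine mul_le_mul_of_nonneg_left ?_ (hP.1 x)
          refine (sum_mul_sub_mean_sq_le (hW.2 x) _ 0).trans ?_
          calc _ ≤ ∑ y, W x y * B ^ 2 := Finset.sum_le_sum fun y _ => by
                refine mul_le_mul_of_nonneg_left ?_ (hW.1 x y)
                rw [sub_zero]
                exact sq_le_sq' (abs_le.1 (hqB y)).1 (abs_le.1 (hqB y)).2
            _ = B ^ 2 := by rw [← Finset.sum_mul, hW.2, one_mul]
      _ = B ^ 2 := by rw [← Finset.sum_mul, hP.2, one_mul]
  have hn1 : 1 ≤ Real.sqrt N := Real.one_le_sqrt.2 (by exact_mod_cast hN)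
  have hμle : N * μ ≤ N * (C - lin - Real.sqrt D ^ 2 / 4) := by
    refine mul_le_mul_of_nonneg_left ?_ hN'.le
    rw [Real.sq_sqrt hD0]
    linarith
  have main := hK (Real.sqrt N) C (Real.log M) lin (Real.sqrt D) v hn1 hlin0 hs0 hv0 hvB
  rw [Real.sq_sqrt hN'.le] at main
  rw [Real.sqrt_mul hN'.le]
  refine main ?_ ?_ ?_
  · refine le_trans ?_ hvar
    have h1 := mul_nonneg (by linarith : 0 ≤ B + |C|) hs0
    have h2 := mul_nonneg hc2 hlin0
    rw [hc]
    linarith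
  · have := log_card_le_mean hW hWw hw0 hq hwq hB1 hqB hN hM f φ he hε1.le hμ
    linarith
  · intro hfar hh
    have hG := stdGaussCDF_log_card_le hW hWw hw0 hq hwq hB1 hqB hN hM f φ he hμ
      (v := V / 4) (by linarith) (by linarith) hv (le_trans (by linarith) hhalf)
    set C₃ := 118 * B / Real.sqrt (V / 4)
    have hC₃ : 0 ≤ C₃ := by positivity
    refine le_trans ?_ (add_le_add_left hμle _)
    by_contra! hlt
    have hvpos : 0 < v := by linarith
    have h1 : z + (C₃ + 1) / (κ * Real.sqrt N) ≤
        (Real.log M - N * μ) / Real.sqrt (N * v) := by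
      rw [le_div_iff₀ (Real.sqrt_pos.2 (by positivity)), Real.sqrt_mul hN'.le]
      linarith
    have h2 := hΦκ _ (by positivity) hh
    have h3 := stdGaussCDF_mono h1
    have h4 : κ * ((C₃ + 1) / (κ * Real.sqrt N)) = C₃ / Real.sqrt N + 1 / Real.sqrt N := by
      field_simp
    have h5 : 0 < 1 / Real.sqrt N := by positivity
    linarith

/-- If the information density is constant then the number of messages is at most
`exp (N * C) / (1 - ε)`. -/
lemma log_card_le_of_le_exp_mul {N M : ℕ} (hW : IsDMC W) (hWw : ∀ x y, W x y ≤ w y)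
    (hw0 : ∀ y, 0 ≤ w y) (hr : IsProbDist r) (hwr : ∀ y, w y ≤ Real.exp C * r y)
    (hε1 : ε < 1 / 2) (hM : 0 < M) (f : Fin M → Fin N → X) (φ : (Fin N → Y) → Fin M)
    (he : avgErrorProb W f φ ≤ ε) : Real.log M ≤ N * C + Real.log 2 := by
  have hM' : (0 : ℝ) < M := by exact_mod_cast hM
  have h1 := one_sub_error_mul_card_le hW hWw hM f φ he (fun _ => True)
  have h2 : ∑ y : Fin N → Y, ∏ n, w (y n) ≤ Real.exp (N * C) := by
    rw [← Fintype.prod_sum]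
    have h3 : ∑ y, w y ≤ Real.exp C := by
      refine (Finset.sum_le_sum fun y _ => hwr y).trans ?_
      rw [← Finset.mul_sum, hr.2, mul_one]
    rw [Finset.prod_const, Finset.card_univ, Fintype.card_fin, Real.exp_nat_mul]
    exact pow_le_pow_left₀ (Finset.sum_nonneg fun y _ => hw0 y) h3 N
  simp only [if_true, prodExp, mul_zero, Finset.sum_const_zero, zero_add] at h1
  have h3 : (M : ℝ) ≤ Real.exp (N * C) * 2 := by nlinarith
  have h4 := Real.log_le_log hM' h3
  rwa [Real.log_mul (Real.exp_pos _).ne' two_ne_zero, Real.log_exp] at h4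

end SecondOrder

/-- **Theorem 4(i)**: for a singular and asymmetric DMC and `ε ∈ (0,1/2)`, there is a constant
`K̃(ε,W) > 0` such that for every blocklength `N ≥ 1`, every constant composition code with `M`
messages and average error probability at most `ε` satisfies
`ln M ≤ N·C(W) + √(N·V_ε(W))·Φ⁻¹(ε) + K̃(ε,W)`. -/
theorem statement5 {X Y : Type} [Fintype X] [Fintype Y] [DecidableEq X]
    [Nonempty X] [Nonempty Y]
    (W : X → Y → ℝ) (hW : IsDMC W) (hasym : ¬ GallagerSymmetric W) (hsing : Singular W)
    (ε : ℝ) (hε0 : 0 < ε) (hε1 : ε < 1 / 2) :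
    ∃ K : ℝ, 0 < K ∧ ∀ N : ℕ, 0 < N → ∀ (R : ℝ),
      ∀ (f : Fin (Mof N R) → Fin N → X) (φ : (Fin N → Y) → Fin (Mof N R)),
        ConstComp f → avgErrorProb W f φ ≤ ε →
          Real.log (Mof N R) ≤
            N * capacity W + Real.sqrt (N * Veps W ε) * stdGaussInvCDF ε + K := by
  obtain ⟨w, hw, hw0, hwx⟩ := exists_outputWeight hW hsing
  obtain ⟨Q, hQ, hQC, hmax⟩ := exists_mutualInfo_eq_capacity hW hw
  have hz := (stdGaussInvCDF_nonpos_and_le hε0 hε1).1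
  have hVeps := Veps_le hW hw hQ hQC hε1 (capacity W)
  have hr := hQ.output hW
  set r : Y → ℝ := fun y => ∑ x, Q x * W x y
  have hwr : ∀ y, 0 < w y → 0 < r y := fun y hy => by
    obtain ⟨x, hx⟩ := hwx y hy
    exact output_pos_of_capacity hW hw hQ hQC hmax hx
  have hrw : ∀ y, w y = 0 → r y = 0 := fun y hy => output_eq_zero hw Q hy
  have hD : ∀ x, ∑ y, W x y * Real.log (w y / r y) ≤ capacity W :=
    sum_mul_log_le_capacity hW hw hwx hQ hQC hmax
  have hWw : ∀ x y, W x y ≤ w y := fun x y => (hw x y).elim (fun h => h ▸ hw0 y) le_of_eq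
  have hM : ∀ N R, 0 < Mof N R := fun N R => Nat.ceil_pos.2 (Real.exp_pos _)
  change Veps W ε ≤ ∑ y, r y * (Real.log (w y / r y) - capacity W) ^ 2 at hVeps
  have hterm : ∀ y, 0 ≤ r y * (Real.log (w y / r y) - capacity W) ^ 2 := fun y =>
    mul_nonneg (hr.1 y) (sq_nonneg _)
  rcases (Finset.sum_nonneg fun y (_ : y ∈ Finset.univ) => hterm y).eq_or_lt with hV | hV
  · refine ⟨Real.log 2, Real.log_pos one_lt_two, fun N hN R f φ _ he => ?_⟩
    have h1 : ∀ y, w y ≤ Real.exp (capacity W) * r y := fun y => by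
      rcases (hw0 y).eq_or_lt with h0 | h0
      · rw [← h0]
        exact mul_nonneg (Real.exp_pos _).le (hr.1 y)
      · have hry := hwr y h0
        have h2 := (Finset.sum_eq_zero_iff_of_nonneg fun y _ => hterm y).1 hV.symm y
          (Finset.mem_univ y)
        have h3 : Real.log (w y / r y) = capacity W :=
          sub_eq_zero.1 (pow_eq_zero_iff two_ne_zero |>.1
            ((mul_eq_zero.1 h2).resolve_left hry.ne'))
        rw [← h3, Real.exp_log (div_pos h0 hry), div_mul_cancel₀ _ hry.ne']
    have h4 := log_card_le_of_le_exp_mul hW hWw hw0 hr h1 hε1 (hM N R) f φ he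
    rw [← hV] at hVeps
    rw [Real.sqrt_eq_zero_of_nonpos (mul_nonpos_of_nonneg_of_nonpos (Nat.cast_nonneg N) hVeps)]
    linarith
  · obtain ⟨K, hK0, hK⟩ := exists_second_order_bound hW hw hw0 hr hwr hrw hD hε0 hε1 hV
    refine ⟨K, hK0, fun N hN R f φ hcc he => (hK N _ hN (hM N R) f φ hcc he).trans ?_⟩
    have h1 : Real.sqrt (N * Veps W ε) ≤
        Real.sqrt (N * ∑ y, r y * (Real.log (w y / r y) - capacity W) ^ 2) := by gcongr
    have h2 := mul_le_mul_of_nonpos_right h1 hz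
    linarith
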